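/- arXiv:1305.4289 — 10 statements merged into one kernel-verified Lean document; each statement's English description precedes it below -/
import Mathlib

section
/- For every n ≥ 1 and all real symmetric n×n matrices X and Y with X ⪰ 0, the following are equivalent: (i) X^{1/2} ⪰ Y ⪰ 0; (ii) there exists a real symmetric n×n matrix W such that the 2n×2n block matrix [[X, W],[W, I_n]] is positive semidefinite and W ⪰ Y ⪰ 0. -/
open Matrix

/-- The power `X^p` of a real symmetric matrix, defined via the spectral
decomposition (powers of the eigenvalues). -/
noncomputable def symPow {n : ℕ} (X : Matrix (Fin n) (Fin n) ℝ) (p : ℝ) :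
    Matrix (Fin n) (Fin n) ℝ :=
  if hX : X.IsHermitian then
    (hX.eigenvectorUnitary : Matrix (Fin n) (Fin n) ℝ) *
      Matrix.diagonal (fun i => hX.eigenvalues i ^ p) *
      (star (hX.eigenvectorUnitary : Matrix (Fin n) (Fin n) ℝ))
  else 0

/-- If `A` and `B` are positive semidefinite and `B² ⪯ A²`, then `B ⪯ A`. -/
theorem Matrix.PosSemidef.sub_of_sq_sub_sq {ι : Type*} [Fintype ι] [DecidableEq ι]
    {A B : Matrix ι ι ℝ} (hA : A.PosSemidef) (hB : B.PosSemidef)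
    (h : (A * A - B * B).PosSemidef) : (A - B).PosSemidef := by
  have hD : (A - B).IsHermitian := hA.1.sub hB.1
  rw [hD.posSemidef_iff_eigenvalues_nonneg]
  intro i
  by_contra hneg
  simp only [Pi.zero_apply, not_le] at hneg
  set v : ι → ℝ := ⇑(hD.eigenvectorBasis i) with hv
  set c := hD.eigenvalues i with hc
  have hev : (A - B) *ᵥ v = c • v := hD.mulVec_eigenvectorBasis i
  have hev' : v ᵥ* (A - B) = c • v := by
    rw [← mulVec_transpose, ← conjTranspose_eq_transpose_of_trivial, hD.eq, hev]
  have hvv : 0 < v ⬝ᵥ v := by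
    have hne : v ≠ 0 := fun h0 =>
      hD.eigenvectorBasis.orthonormal.ne_zero i (by ext j; exact congrFun h0 j)
    simpa using dotProduct_star_self_pos_iff.2 hne
  have h1 : 0 ≤ v ⬝ᵥ A *ᵥ v := by simpa using hA.dotProduct_mulVec_nonneg v
  have h2 : 0 ≤ v ⬝ᵥ B *ᵥ v := by simpa using hB.dotProduct_mulVec_nonneg v
  have h3 : 0 ≤ v ⬝ᵥ (A * A - B * B) *ᵥ v := by simpa using h.dotProduct_mulVec_nonneg v
  have hsplit : A * A - B * B = A * (A - B) + (A - B) * B := by noncomm_ring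
  rw [hsplit, add_mulVec, dotProduct_add, ← mulVec_mulVec, ← mulVec_mulVec, hev,
    dotProduct_mulVec v (A - B), hev', mulVec_smul, dotProduct_smul, smul_dotProduct,
    smul_eq_mul, smul_eq_mul] at h3
  have h4 : v ⬝ᵥ A *ᵥ v - v ⬝ᵥ B *ᵥ v = c * (v ⬝ᵥ v) := by
    rw [← dotProduct_sub, ← sub_mulVec, hev, dotProduct_smul, smul_eq_mul]
  nlinarith [mul_neg_of_neg_of_pos hneg hvv]

theorem symPow_posSemidef {n : ℕ} {X : Matrix (Fin n) (Fin n) ℝ} (hX : X.PosSemidef) (p : ℝ) :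
    (symPow X p).PosSemidef := by
  rw [symPow, dif_pos hX.1]
  exact (PosSemidef.diagonal fun i =>
    Real.rpow_nonneg (hX.eigenvalues_nonneg i) p).mul_mul_conjTranspose_same _

theorem symPow_half_mul_self {n : ℕ} {X : Matrix (Fin n) (Fin n) ℝ} (hX : X.PosSemidef) :
    symPow X (1 / 2) * symPow X (1 / 2) = X := by
  rw [symPow, dif_pos hX.1]
  set U := hX.1.eigenvectorUnitary
  have hU : star (U : Matrix (Fin n) (Fin n) ℝ) * U = 1 := Unitary.coe_star_mul_self U
  have hdiag : diagonal (fun i => hX.1.eigenvalues i ^ (1 / 2 : ℝ)) *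
      diagonal (fun i => hX.1.eigenvalues i ^ (1 / 2 : ℝ)) = diagonal hX.1.eigenvalues := by
    rw [diagonal_mul_diagonal]
    congr 1
    ext i
    rw [← Real.sqrt_eq_rpow, Real.mul_self_sqrt (hX.eigenvalues_nonneg i)]
  have hspec : X = (U : Matrix (Fin n) (Fin n) ℝ) * diagonal hX.1.eigenvalues *
      star (U : Matrix (Fin n) (Fin n) ℝ) := by
    simpa [Unitary.conjStarAlgAut_apply, Function.comp_def] using hX.1.spectral_theorem
  conv_rhs => rw [hspec, ← hdiag]
  simp only [Matrix.mul_assoc]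
  rw [← Matrix.mul_assoc (star _) (U : Matrix (Fin n) (Fin n) ℝ), hU, Matrix.one_mul]

/-- Schur complement criterion for a symmetric block matrix with identity corner. -/
theorem Matrix.posSemidef_fromBlocks_one_iff {ι : Type*} [Fintype ι] [DecidableEq ι]
    {X W : Matrix ι ι ℝ} (hW : W.IsHermitian) :
    (fromBlocks X W W 1).PosSemidef ↔ (X - W * W).PosSemidef := by
  have : Invertible (1 : Matrix ι ι ℝ) := invertibleOne
  have h := PosDef.fromBlocks₂₂ X W (PosDef.one (n := ι) (R := ℝ))
  rwa [hW.eq, inv_one, Matrix.mul_one] at h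

/-- For every `n ≥ 1` and real symmetric `n × n` matrices `X ⪰ 0` and `Y`:
`X^{1/2} ⪰ Y ⪰ 0` iff there is a real symmetric `W` with
`[[X, W], [W, I]] ⪰ 0` and `W ⪰ Y ⪰ 0`. -/
theorem sqrt_hypograph_sdr (n : ℕ) (hn : 1 ≤ n)
    (X Y : Matrix (Fin n) (Fin n) ℝ) (hX : X.PosSemidef) (hY : Y.IsHermitian) :
    ((symPow X (1 / 2) - Y).PosSemidef ∧ Y.PosSemidef)
      ↔
    (∃ W : Matrix (Fin n) (Fin n) ℝ, W.IsHermitian ∧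
      (Matrix.fromBlocks X W W 1).PosSemidef ∧
      (W - Y).PosSemidef ∧ Y.PosSemidef) := by
  have hS := symPow_posSemidef hX (1 / 2)
  constructor
  · rintro ⟨hSY, hY0⟩
    refine ⟨symPow X (1 / 2), hS.1, ?_, hSY, hY0⟩
    rw [posSemidef_fromBlocks_one_iff hS.1, symPow_half_mul_self hX, sub_self]
    exact PosSemidef.zero
  · rintro ⟨W, hW, hblock, hWY, hY0⟩
    have hW0 : W.PosSemidef := by simpa using hWY.add hY0
    rw [posSemidef_fromBlocks_one_iff hW, ← symPow_half_mul_self hX] at hblock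
    refine ⟨?_, hY0⟩
    simpa using (hS.sub_of_sq_sub_sq hW0 hblock).add hWY
end

section
/- Let d ≥ 1 be an integer. For every n ≥ 1 and all real symmetric n×n matrices X and Y with X ⪰ 0, the following are equivalent: (i) X^{1/(2d+1)} ⪰ Y ⪰ 0; (ii) there exist real symmetric n×n matrices W and Z with W ⪰ 0 such that the block matrix [[X, W],[W, Z]] is positive semidefinite and W^{1/(d+1)} ⪰ Z ⪰ Y ⪰ 0. -/
open Matrix

namespace Matrix

variable {n : ℕ}

open scoped ComplexOrder MatrixOrder in
lemma posSemidef_map_ofReal_iff {A : Matrix (Fin n) (Fin n) ℝ} :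
    (A.map Complex.ofRealHom).PosSemidef ↔ A.PosSemidef := by
  constructor
  · intro h
    refine .of_dotProduct_mulVec_nonneg ?_ fun x ↦ ?_
    · ext i j
      simpa using congrFun₂ h.isHermitian i j
    · have hx := h.dotProduct_mulVec_nonneg (Complex.ofRealHom ∘ x)
      have hcast : star (Complex.ofRealHom ∘ x) ⬝ᵥ (A.map Complex.ofRealHom *ᵥ
          (Complex.ofRealHom ∘ x)) = ((star x ⬝ᵥ (A *ᵥ x) : ℝ) : ℂ) := by
        simp [dotProduct, mulVec]
      rw [hcast] at hx
      exact_mod_cast hx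
  · intro h
    obtain ⟨B, rfl⟩ := CStarAlgebra.nonneg_iff_eq_star_mul_self.mp h.nonneg
    have hB : Bᴴ.map Complex.ofRealHom = (B.map Complex.ofRealHom)ᴴ := by
      ext i j
      simp
    rw [star_eq_conjTranspose, Matrix.map_mul, hB]
    exact posSemidef_conjTranspose_mul_self _

open scoped ComplexOrder MatrixOrder Matrix.Norms.L2Operator in
/-- Operator monotonicity of the `m`-th root on complex positive semidefinite matrices. -/
lemma PosSemidef.sub_of_pow_sub_complex {A B : Matrix (Fin n) (Fin n) ℂ} (hA : A.PosSemidef)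
    (hB : B.PosSemidef) {m : ℕ} (hm : m ≠ 0) (h : (B ^ m - A ^ m).PosSemidef) :
    (B - A).PosSemidef := by
  have root_pow {C : Matrix (Fin n) (Fin n) ℂ} (hC : C.PosSemidef) :
      (C ^ m) ^ ((m : ℝ)⁻¹) = C := by
    have hC' : 0 ≤ C := nonneg_iff_posSemidef.mpr hC
    rw [← CFC.rpow_natCast C m hC', CFC.rpow_rpow_of_exponent_nonneg C _ _ (by positivity)
      (by positivity) hC', mul_inv_cancel₀ (by exact_mod_cast hm), CFC.rpow_one C hC']
  have hm' : (m : ℝ)⁻¹ ∈ Set.Icc (0 : ℝ) 1 :=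
    ⟨by positivity, inv_le_one_of_one_le₀ (by exact_mod_cast Nat.one_le_iff_ne_zero.mpr hm)⟩
  have hle := CFC.rpow_le_rpow hm' (le_iff.mpr h)
  rwa [root_pow hA, root_pow hB] at hle

open scoped ComplexOrder in
/-- Operator monotonicity of the `m`-th root on real positive semidefinite matrices. -/
lemma PosSemidef.sub_of_pow_sub {A B : Matrix (Fin n) (Fin n) ℝ} (hA : A.PosSemidef)
    (hB : B.PosSemidef) {m : ℕ} (hm : m ≠ 0) (h : (B ^ m - A ^ m).PosSemidef) :
    (B - A).PosSemidef := by
  rw [← posSemidef_map_ofReal_iff] at hA hB h ⊢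
  have map_sub (C D : Matrix (Fin n) (Fin n) ℝ) : (C - D).map Complex.ofRealHom =
      C.map Complex.ofRealHom - D.map Complex.ofRealHom := by
    ext i j
    simp
  rw [map_sub, Matrix.map_pow, Matrix.map_pow] at h
  rw [map_sub]
  exact hA.sub_of_pow_sub_complex hB hm h

open scoped MatrixOrder in
lemma PosSemidef.eq_of_pow_eq {A B : Matrix (Fin n) (Fin n) ℝ} (hA : A.PosSemidef)
    (hB : B.PosSemidef) {m : ℕ} (hm : m ≠ 0) (h : A ^ m = B ^ m) : A = B :=
  le_antisymm (le_iff.mpr (hA.sub_of_pow_sub hB hm (by simpa [h] using PosSemidef.zero)))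
    (le_iff.mpr (hB.sub_of_pow_sub hA hm (by simpa [h] using PosSemidef.zero)))

lemma PosSemidef.symPow {X : Matrix (Fin n) (Fin n) ℝ} (hX : X.PosSemidef) (p : ℝ) :
    (symPow X p).PosSemidef := by
  rw [_root_.symPow, dif_pos hX.isHermitian]
  exact (PosSemidef.diagonal fun i ↦ Real.rpow_nonneg (hX.eigenvalues_nonneg i) p)
    |>.mul_mul_conjTranspose_same _

lemma PosSemidef.symPow_inv_pow {X : Matrix (Fin n) (Fin n) ℝ} (hX : X.PosSemidef) {m : ℕ}
    (hm : m ≠ 0) : (_root_.symPow X (m : ℝ)⁻¹) ^ m = X := by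
  have hconj : _root_.symPow X (m : ℝ)⁻¹ =
      Unitary.conjStarAlgAut ℝ _ hX.isHermitian.eigenvectorUnitary
        (diagonal fun i ↦ hX.isHermitian.eigenvalues i ^ (m : ℝ)⁻¹) := by
    rw [_root_.symPow, dif_pos hX.isHermitian, Unitary.conjStarAlgAut_apply]
  conv_rhs => rw [hX.isHermitian.spectral_theorem]
  rw [hconj, ← map_pow, diagonal_pow]
  congr 2
  ext i
  simp [Real.rpow_inv_natCast_pow (hX.eigenvalues_nonneg i) hm]

lemma PosSemidef.symPow_pow_inv {X : Matrix (Fin n) (Fin n) ℝ} (hX : X.PosSemidef) {m : ℕ}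
    (hm : m ≠ 0) : _root_.symPow (X ^ m) (m : ℝ)⁻¹ = X :=
  ((hX.pow m).symPow _).eq_of_pow_eq hX hm ((hX.pow m).symPow_inv_pow hm)

lemma PosSemidef.fromBlocks_pow {R : Matrix (Fin n) (Fin n) ℝ} (hR : R.PosSemidef) (d : ℕ) :
    (fromBlocks (R ^ (2 * d + 1)) (R ^ (d + 1)) (R ^ (d + 1)) R).PosSemidef := by
  have h := hR.mul_mul_conjTranspose_same (fromRows (R ^ d) (1 : Matrix (Fin n) (Fin n) ℝ))
  rwa [conjTranspose_fromRows_eq_fromCols_conjTranspose, fromRows_mul, fromRows_mul_fromCols,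
    (hR.pow d).isHermitian.eq, conjTranspose_one, one_mul, mul_one, mul_one, ← pow_succ,
    ← pow_succ', ← pow_add, show d + 1 + d = 2 * d + 1 by ring] at h

/-- The block condition, with the lower right corner bounded by `S`, forces `S ^ (2 * d + 1) ⪯ X`. -/
lemma PosSemidef.sub_pow_of_fromBlocks {X S Z : Matrix (Fin n) (Fin n) ℝ} {d : ℕ}
    (hS : S.PosSemidef) (h : (fromBlocks X (S ^ (d + 1)) (S ^ (d + 1)) Z).PosSemidef)
    (hZ : (S - Z).PosSemidef) : (X - S ^ (2 * d + 1)).PosSemidef := by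
  have hSd : (S ^ d)ᴴ = S ^ d := (hS.pow d).isHermitian.eq
  have hblock := h.conjTranspose_mul_mul_same (fromRows 1 (-S ^ d))
  have hcorner := hZ.conjTranspose_mul_mul_same (S ^ d)
  convert hblock.add hcorner using 1
  rw [Matrix.mul_assoc, fromBlocks_mul_fromRows,
    conjTranspose_fromRows_eq_fromCols_conjTranspose, fromCols_mul_fromRows, conjTranspose_neg,
    hSd, conjTranspose_one]
  have hpow : S ^ (2 * d + 1) = S ^ d * S * S ^ d := by
    rw [← pow_succ, ← pow_add]
    ring_nf
  have hpow_left : S ^ (d + 1) * S ^ d = S ^ d * S * S ^ d := by rw [pow_succ]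
  have hpow_right : S ^ d * S ^ (d + 1) = S ^ d * S * S ^ d := by rw [pow_succ', Matrix.mul_assoc]
  simp only [mul_neg, neg_mul, mul_one, one_mul, mul_add, mul_sub, sub_mul, hpow, hpow_left,
    hpow_right, Matrix.mul_assoc]
  abel

end Matrix

/-- Let `d ≥ 1`.  For every `n ≥ 1` and real symmetric `n × n` matrices
`X ⪰ 0` and `Y`:  `X^{1/(2d+1)} ⪰ Y ⪰ 0` iff there are real symmetric
matrices `W ⪰ 0` and `Z` with `[[X, W], [W, Z]] ⪰ 0` and
`W^{1/(d+1)} ⪰ Z ⪰ Y ⪰ 0`. -/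
theorem odd_reciprocal_power_hypograph_sdr (d : ℕ) (hd : 1 ≤ d)
    (n : ℕ) (hn : 1 ≤ n)
    (X Y : Matrix (Fin n) (Fin n) ℝ) (hX : X.PosSemidef) (hY : Y.IsHermitian) :
    ((symPow X (1 / (2 * (d : ℝ) + 1)) - Y).PosSemidef ∧ Y.PosSemidef)
      ↔
    (∃ W Z : Matrix (Fin n) (Fin n) ℝ, W.IsHermitian ∧ Z.IsHermitian ∧
      W.PosSemidef ∧
      (Matrix.fromBlocks X W W Z).PosSemidef ∧
      (symPow W (1 / ((d : ℝ) + 1)) - Z).PosSemidef ∧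
      (Z - Y).PosSemidef ∧ Y.PosSemidef) := by
  have hm : 2 * d + 1 ≠ 0 := by omega
  have hk : d + 1 ≠ 0 := by omega
  have hm_inv : 1 / (2 * (d : ℝ) + 1) = ((2 * d + 1 : ℕ) : ℝ)⁻¹ := by push_cast; rw [one_div]
  have hk_inv : 1 / ((d : ℝ) + 1) = ((d + 1 : ℕ) : ℝ)⁻¹ := by push_cast; rw [one_div]
  rw [hm_inv, hk_inv]
  have hR := hX.symPow ((2 * d + 1 : ℕ) : ℝ)⁻¹
  have hRX := hX.symPow_inv_pow hm
  constructor
  · rintro ⟨hRY, hY⟩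
    refine ⟨symPow X ((2 * d + 1 : ℕ) : ℝ)⁻¹ ^ (d + 1), symPow X ((2 * d + 1 : ℕ) : ℝ)⁻¹,
      (hR.pow _).isHermitian, hR.isHermitian, hR.pow _, ?_, ?_, hRY, hY⟩
    · simpa only [hRX] using hR.fromBlocks_pow d
    · rw [hR.symPow_pow_inv hk, sub_self]
      exact PosSemidef.zero
  · rintro ⟨W, Z, -, -, hW, hblock, hWZ, hZY, hY⟩
    refine ⟨?_, hY⟩
    have hS := hW.symPow ((d + 1 : ℕ) : ℝ)⁻¹
    rw [← hW.symPow_inv_pow hk] at hblock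
    have hXS := hS.sub_pow_of_fromBlocks hblock hWZ
    rw [← hRX] at hXS
    simpa using ((hS.sub_of_pow_sub hR hm hXS).add hWZ).add hZY
end

section
/- For every positive integer m, the hypograph of X^{1/m} admits a free semidefinite representation: there exist positive integers ℓ and g′ and real symmetric ℓ×ℓ matrices A₀, A₁, A₂, B₁, …, B_{g′} (independent of n) such that for every n ≥ 1 and all real symmetric n×n matrices X, Y with X ⪰ 0, one has X^{1/m} ⪰ Y ⪰ 0 if and only if there exist real symmetric n×n matrices W₁, …, W_{g′} with A₀ ⊗ I_n + A₁ ⊗ X + A₂ ⊗ Y + Σ_{j=1}^{g′} B_j ⊗ W_j positive semidefinite. -/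
open Matrix

section Spectral

variable {n : Type*} [Fintype n]

/-- Nonnegativity of the quadratic form of a real positive semidefinite matrix. -/
theorem Matrix.PosSemidef.real_form_nonneg {M : Matrix n n ℝ} (hM : M.PosSemidef) (x : n → ℝ) :
    0 ≤ x ⬝ᵥ (M *ᵥ x) := by
  simpa using hM.dotProduct_mulVec_nonneg x

/-- A real symmetric matrix with nonnegative quadratic form is positive semidefinite. -/
theorem Matrix.IsHermitian.posSemidef_of_real_form {M : Matrix n n ℝ} (hM : M.IsHermitian)
    (h : ∀ x : n → ℝ, 0 ≤ x ⬝ᵥ (M *ᵥ x)) : M.PosSemidef :=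
  .of_dotProduct_mulVec_nonneg hM fun x => by simpa using h x

/-- A real symmetric matrix can be moved across the dot product. -/
theorem Matrix.IsHermitian.mulVec_dotProduct {M : Matrix n n ℝ} (hM : M.IsHermitian)
    (u v : n → ℝ) : (M *ᵥ u) ⬝ᵥ v = u ⬝ᵥ (M *ᵥ v) := by
  have hT : Mᵀ = M := by simpa [IsHermitian, conjTranspose_eq_transpose_of_trivial] using hM
  rw [dotProduct_mulVec, ← mulVec_transpose, hT]

variable [DecidableEq n]

open scoped MatrixOrder ComplexOrder in
theorem posSemidef_map_ofReal_iff {M : Matrix n n ℝ} :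
    (M.map Complex.ofReal).PosSemidef ↔ M.PosSemidef := by
  constructor
  · intro h
    have hM : M.IsHermitian := by
      ext i j
      have := congrFun (congrFun h.1 i) j
      simpa using this
    refine hM.posSemidef_of_real_form fun x => ?_
    have hx := h.dotProduct_mulVec_nonneg (fun i => (x i : ℂ))
    have e : star (fun i => (x i : ℂ)) ⬝ᵥ (M.map Complex.ofReal *ᵥ fun i => (x i : ℂ))
        = ((x ⬝ᵥ (M *ᵥ x) : ℝ) : ℂ) := by
      simp [dotProduct, mulVec]
    rw [e] at hx
    exact_mod_cast hx
  · intro h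
    obtain ⟨B, rfl⟩ := CStarAlgebra.nonneg_iff_eq_star_mul_self.mp h.nonneg
    have e : (star B * B).map Complex.ofReal
        = (B.map Complex.ofReal)ᴴ * B.map Complex.ofReal := by
      ext i j
      simp [mul_apply]
    rw [e]
    exact posSemidef_conjTranspose_mul_self _

open scoped MatrixOrder ComplexOrder Matrix.Norms.L2Operator in
/-- Operator monotonicity of the `m`-th root, stated through powers. -/
theorem posSemidef_sub_of_pow {A B : Matrix n n ℝ} (hA : A.PosSemidef) (hB : B.PosSemidef)
    {m : ℕ} (hm : m ≠ 0) (h : (B ^ m - A ^ m).PosSemidef) : (B - A).PosSemidef := by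
  let φ : Matrix n n ℝ →+* Matrix n n ℂ := Complex.ofRealHom.mapMatrix
  have hφ (M : Matrix n n ℝ) : (φ M).PosSemidef ↔ M.PosSemidef := posSemidef_map_ofReal_iff
  have hle : φ A ^ m ≤ φ B ^ m := by
    rw [Matrix.le_iff, ← map_pow, ← map_pow, ← map_sub]
    exact (hφ _).2 h
  have hroot {M : Matrix n n ℝ} (hM : M.PosSemidef) : (φ M ^ m) ^ (1 / (m : ℝ)) = φ M := by
    have h0 : 0 ≤ φ M := ((hφ _).2 hM).nonneg
    rw [← CFC.rpow_natCast _ m h0, CFC.rpow_rpow_of_exponent_nonneg _ _ _ (by positivity)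
      (by positivity) h0, mul_one_div_cancel (by exact_mod_cast hm), CFC.rpow_one _ h0]
  have hm1 : (1 : ℝ) ≤ m := by exact_mod_cast Nat.one_le_iff_ne_zero.2 hm
  have := CFC.rpow_le_rpow (p := 1 / (m : ℝ))
    ⟨by positivity, by rw [div_le_one (by positivity)]; exact hm1⟩ hle
  rw [hroot hA, hroot hB, Matrix.le_iff, ← map_sub] at this
  exact (hφ _).1 this

end Spectral

theorem symPow_one_div_pow {n : ℕ} {X : Matrix (Fin n) (Fin n) ℝ} (hX : X.PosSemidef)
    {m : ℕ} (hm : m ≠ 0) : symPow X (1 / (m : ℝ)) ^ m = X := by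
  have hH := hX.isHermitian
  have hd : Matrix.diagonal (fun i => hH.eigenvalues i ^ (1 / (m : ℝ))) ^ m
      = Matrix.diagonal (RCLike.ofReal ∘ hH.eigenvalues : Fin n → ℝ) := by
    rw [diagonal_pow]
    congr 1
    ext i
    simpa using Real.rpow_inv_natCast_pow (hX.eigenvalues_nonneg i) hm
  have hs : symPow X (1 / (m : ℝ)) = Unitary.conjStarAlgAut ℝ _ hH.eigenvectorUnitary
      (Matrix.diagonal (fun i => hH.eigenvalues i ^ (1 / (m : ℝ)))) := by
    rw [symPow, dif_pos hH, Unitary.conjStarAlgAut_apply]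
  rw [hs, ← map_pow, hd]
  exact hH.spectral_theorem.symm

/-- A symmetric linear pencil in two distinguished matrix variables and auxiliary matrix variables
indexed by `τ`, with coefficients of size `l`. -/
structure FreePencil (l τ : Type) where
  /-- The constant coefficient. -/
  const : Matrix l l ℝ
  /-- The coefficient of the first variable. -/
  fst : Matrix l l ℝ
  /-- The coefficient of the second variable. -/
  snd : Matrix l l ℝ
  /-- The coefficients of the auxiliary variables. -/
  aux : τ → Matrix l l ℝ
  const_herm : const.IsHermitian
  fst_herm : fst.IsHermitian
  snd_herm : snd.IsHermitian
  aux_herm : ∀ t, (aux t).IsHermitian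

namespace FreePencil

variable {l τ κ : Type} [Fintype l] [Fintype τ] [Fintype κ] {n : Type} [Fintype n] [DecidableEq n]

/-- The `(i, j)` block of the evaluation of a pencil. -/
def block (P : FreePencil l τ) (X Y : Matrix n n ℝ) (W : τ → Matrix n n ℝ) (i j : l) :
    Matrix n n ℝ :=
  P.const i j • 1 + P.fst i j • X + P.snd i j • Y + ∑ t, P.aux t i j • W t

/-- The quadratic form of the evaluation of a pencil. -/
def form (P : FreePencil l τ) (X Y : Matrix n n ℝ) (W : τ → Matrix n n ℝ) (x : l → n → ℝ) : ℝ :=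
  ∑ i, ∑ j, x i ⬝ᵥ (P.block X Y W i j *ᵥ x j)

open Kronecker in
theorem posSemidef_iff_form_nonneg (P : FreePencil l τ) {X Y : Matrix n n ℝ}
    {W : τ → Matrix n n ℝ} (hX : X.IsHermitian) (hY : Y.IsHermitian)
    (hW : ∀ t, (W t).IsHermitian) :
    (P.const ⊗ₖ (1 : Matrix n n ℝ) + P.fst ⊗ₖ X + P.snd ⊗ₖ Y + ∑ t, P.aux t ⊗ₖ W t).PosSemidef ↔
      ∀ x, 0 ≤ P.form X Y W x := by
  have hk {A : Matrix l l ℝ} {B : Matrix n n ℝ} (hA : A.IsHermitian) (hB : B.IsHermitian) :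
      (A ⊗ₖ B).IsHermitian := by
    rw [IsHermitian, conjTranspose_kronecker, hA.eq, hB.eq]
  set M := P.const ⊗ₖ (1 : Matrix n n ℝ) + P.fst ⊗ₖ X + P.snd ⊗ₖ Y + ∑ t, P.aux t ⊗ₖ W t with hM
  have hherm : M.IsHermitian := by
    refine (((hk P.const_herm isHermitian_one).add (hk P.fst_herm hX)).add
      (hk P.snd_herm hY)).add ?_
    rw [IsHermitian, conjTranspose_sum]
    exact Finset.sum_congr rfl fun t _ => hk (P.aux_herm t) (hW t)
  have hblock (i j : l) (a b : n) : M (i, a) (j, b) = P.block X Y W i j a b := by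
    simp [hM, block, Matrix.sum_apply]
  have hform (x : l → n → ℝ) :
      (fun p : l × n => x p.1 p.2) ⬝ᵥ (M *ᵥ fun p : l × n => x p.1 p.2) = P.form X Y W x := by
    simp only [form, dotProduct, mulVec, Fintype.sum_prod_type, hblock, Finset.mul_sum]
    exact Finset.sum_congr rfl fun i _ => Finset.sum_comm
  constructor
  · intro h x
    rw [← hform]
    exact h.real_form_nonneg _
  · intro h
    refine hherm.posSemidef_of_real_form fun x => ?_
    have := h fun i a => x (i, a)
    rwa [← hform] at this

/-- Transport of a pencil along equivalences of the index types. -/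
def reindex {l' τ' : Type} (P : FreePencil l τ) (e : l ≃ l') (f : τ ≃ τ') : FreePencil l' τ' where
  const := P.const.submatrix e.symm e.symm
  fst := P.fst.submatrix e.symm e.symm
  snd := P.snd.submatrix e.symm e.symm
  aux t := (P.aux (f.symm t)).submatrix e.symm e.symm
  const_herm := P.const_herm.submatrix _
  fst_herm := P.fst_herm.submatrix _
  snd_herm := P.snd_herm.submatrix _
  aux_herm _ := (P.aux_herm _).submatrix _

theorem form_reindex {l' τ' : Type} [Fintype l'] [Fintype τ'] (P : FreePencil l τ) (e : l ≃ l')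
    (f : τ ≃ τ') (X Y : Matrix n n ℝ) (W : τ' → Matrix n n ℝ) (x : l' → n → ℝ) :
    (P.reindex e f).form X Y W x = P.form X Y (W ∘ f) (x ∘ e) := by
  have hb (i j : l) : (P.reindex e f).block X Y W (e i) (e j) = P.block X Y (W ∘ f) i j := by
    simp only [block, reindex, submatrix_apply, Equiv.symm_apply_apply, Function.comp_apply]
    congr 1
    rw [← f.sum_comp]
    simp
  simp only [form, ← e.sum_comp, hb, Function.comp_apply]

/-- The direct sum of a pencil `P` evaluated at two auxiliary variables of `Q` and the pencil `Q`
evaluated at the distinguished variables. -/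
def chain (P : FreePencil l τ) (Q : FreePencil κ (Fin 2)) : FreePencil (l ⊕ κ) (τ ⊕ Fin 2) where
  const := fromBlocks P.const 0 0 Q.const
  fst := fromBlocks 0 0 0 Q.fst
  snd := fromBlocks 0 0 0 Q.snd
  aux := Sum.elim (fun t => fromBlocks (P.aux t) 0 0 0)
    ![fromBlocks P.fst 0 0 (Q.aux 0), fromBlocks P.snd 0 0 (Q.aux 1)]
  const_herm := P.const_herm.fromBlocks (by simp) Q.const_herm
  fst_herm := isHermitian_zero.fromBlocks (by simp) Q.fst_herm
  snd_herm := isHermitian_zero.fromBlocks (by simp) Q.snd_herm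
  aux_herm := by
    rintro (t | t)
    · exact (P.aux_herm t).fromBlocks (by simp) isHermitian_zero
    · fin_cases t
      · exact P.fst_herm.fromBlocks (by simp) (Q.aux_herm 0)
      · exact P.snd_herm.fromBlocks (by simp) (Q.aux_herm 1)

theorem form_chain (P : FreePencil l τ) (Q : FreePencil κ (Fin 2)) (X Y : Matrix n n ℝ)
    (W : τ ⊕ Fin 2 → Matrix n n ℝ) (x : l ⊕ κ → n → ℝ) :
    (P.chain Q).form X Y W x =
      P.form (W (Sum.inr 0)) (W (Sum.inr 1)) (W ∘ Sum.inl) (x ∘ Sum.inl) +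
        Q.form X Y (W ∘ Sum.inr) (x ∘ Sum.inr) := by
  have h₁₁ (i j : l) : (P.chain Q).block X Y W (Sum.inl i) (Sum.inl j) =
      P.block (W (Sum.inr 0)) (W (Sum.inr 1)) (W ∘ Sum.inl) i j := by
    simp [block, chain]
    abel
  have h₁₂ (i : l) (j : κ) : (P.chain Q).block X Y W (Sum.inl i) (Sum.inr j) = 0 := by
    simp [block, chain]
  have h₂₁ (i : κ) (j : l) : (P.chain Q).block X Y W (Sum.inr i) (Sum.inl j) = 0 := by
    simp [block, chain]
  have h₂₂ (i j : κ) : (P.chain Q).block X Y W (Sum.inr i) (Sum.inr j) =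
      Q.block X Y (W ∘ Sum.inr) i j := by
    simp [block, chain]
  simp [form, Fintype.sum_sum_type, h₁₁, h₁₂, h₂₁, h₂₂]

theorem form_chain_nonneg_iff (P : FreePencil l τ) (Q : FreePencil κ (Fin 2)) (X Y : Matrix n n ℝ)
    (W : τ ⊕ Fin 2 → Matrix n n ℝ) :
    (∀ x, 0 ≤ (P.chain Q).form X Y W x) ↔
      (∀ x, 0 ≤ P.form (W (Sum.inr 0)) (W (Sum.inr 1)) (W ∘ Sum.inl) x) ∧
        ∀ x, 0 ≤ Q.form X Y (W ∘ Sum.inr) x := by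
  simp only [form_chain]
  refine ⟨fun h => ⟨fun x => ?_, fun x => ?_⟩, fun h x => add_nonneg (h.1 _) (h.2 _)⟩
  · simpa [form] using h (Sum.elim x 0)
  · simpa [form] using h (Sum.elim 0 x)

/-- The pencil with diagonal blocks `X - Y` and `Y`, and a dummy auxiliary variable. -/
def interval : FreePencil (Fin 2) (Fin 1) where
  const := 0
  fst := !![1, 0; 0, 0]
  snd := !![-1, 0; 0, 1]
  aux _ := 0
  const_herm := isHermitian_zero
  fst_herm := by ext i j; fin_cases i <;> fin_cases j <;> simp
  snd_herm := by ext i j; fin_cases i <;> fin_cases j <;> simp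
  aux_herm _ := isHermitian_zero

theorem form_interval (X Y : Matrix n n ℝ) (W : Fin 1 → Matrix n n ℝ) (x : Fin 2 → n → ℝ) :
    interval.form X Y W x = x 0 ⬝ᵥ ((X - Y) *ᵥ x 0) + x 1 ⬝ᵥ (Y *ᵥ x 1) := by
  simp [form, block, interval, sub_eq_add_neg]

/-- The pencil in auxiliary variables `W`, `Z` with diagonal blocks `Z - Y`, `Y`, `W` and
`[X, W; W, e + (1 - e) Z]`. -/
def link (e : ℝ) : FreePencil (Fin 5) (Fin 2) where
  const := diagonal ![0, 0, 0, 0, e]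
  fst := diagonal ![0, 0, 0, 1, 0]
  snd := diagonal ![-1, 1, 0, 0, 0]
  aux := ![!![0, 0, 0, 0, 0; 0, 0, 0, 0, 0; 0, 0, 1, 0, 0; 0, 0, 0, 0, 1; 0, 0, 0, 1, 0],
    diagonal ![1, 0, 0, 0, 1 - e]]
  const_herm := isHermitian_diagonal _
  fst_herm := isHermitian_diagonal _
  snd_herm := isHermitian_diagonal _
  aux_herm t := by
    fin_cases t
    · ext i j
      fin_cases i <;> fin_cases j <;> simp
    · exact isHermitian_diagonal _

theorem form_link (e : ℝ) (X Y : Matrix n n ℝ) (W : Fin 2 → Matrix n n ℝ) (x : Fin 5 → n → ℝ) :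
    (link e).form X Y W x =
      x 0 ⬝ᵥ ((W 1 - Y) *ᵥ x 0) + x 1 ⬝ᵥ (Y *ᵥ x 1) + x 2 ⬝ᵥ (W 0 *ᵥ x 2) +
        (x 3 ⬝ᵥ (X *ᵥ x 3) + x 3 ⬝ᵥ (W 0 *ᵥ x 4) + x 4 ⬝ᵥ (W 0 *ᵥ x 3) +
          x 4 ⬝ᵥ ((e • 1 + (1 - e) • W 1) *ᵥ x 4)) := by
  simp [form, block, link, Fin.sum_univ_five, sub_eq_add_neg, add_mulVec, diagonal_apply]
  ring

theorem form_link_nonneg_iff (e : ℝ) {X Y : Matrix n n ℝ} {W : Fin 2 → Matrix n n ℝ}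
    (hY : Y.IsHermitian) (hW : ∀ t, (W t).IsHermitian) :
    (∀ x, 0 ≤ (link e).form X Y W x) ↔
      (W 1 - Y).PosSemidef ∧ Y.PosSemidef ∧ (W 0).PosSemidef ∧
        ∀ u v : n → ℝ, 0 ≤ u ⬝ᵥ (X *ᵥ u) + u ⬝ᵥ (W 0 *ᵥ v) + v ⬝ᵥ (W 0 *ᵥ u) +
          v ⬝ᵥ ((e • 1 + (1 - e) • W 1) *ᵥ v) := by
  simp only [form_link]
  constructor
  · intro h
    refine ⟨((hW 1).sub hY).posSemidef_of_real_form fun u => ?_,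
      hY.posSemidef_of_real_form fun u => ?_, (hW 0).posSemidef_of_real_form fun u => ?_,
      fun u v => ?_⟩
    · simpa using h ![u, 0, 0, 0, 0]
    · simpa using h ![0, u, 0, 0, 0]
    · simpa using h ![0, 0, u, 0, 0]
    · simpa using h ![0, 0, 0, u, v]
  · rintro ⟨h₀, h₁, h₂, h₃⟩ x
    have := h₀.real_form_nonneg (x 0)
    have := h₁.real_form_nonneg (x 1)
    have := h₂.real_form_nonneg (x 2)
    have := h₃ (x 3) (x 4)
    positivity

/-- The pencil `P` represents the hypograph of the `m`-th root; the first variable is written as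
the `m`-th power of a positive semidefinite matrix. -/
def RepresentsRoot (P : FreePencil l τ) (m : ℕ) : Prop :=
  ∀ (n : ℕ) (S Y : Matrix (Fin n) (Fin n) ℝ), S.PosSemidef → Y.IsHermitian →
    (((S - Y).PosSemidef ∧ Y.PosSemidef) ↔
      ∃ W : τ → Matrix (Fin n) (Fin n) ℝ, (∀ t, (W t).IsHermitian) ∧
        ∀ x, 0 ≤ P.form (S ^ m) Y W x)

theorem interval_representsRoot : interval.RepresentsRoot 1 := by
  intro n S Y hS hY
  simp only [form_interval, pow_one]
  constructor
  · rintro ⟨h₁, h₂⟩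
    exact ⟨0, fun _ => isHermitian_zero, fun x =>
      add_nonneg (h₁.real_form_nonneg _) (h₂.real_form_nonneg _)⟩
  · rintro ⟨W, -, h⟩
    refine ⟨(hS.isHermitian.sub hY).posSemidef_of_real_form fun u => ?_,
      hY.posSemidef_of_real_form fun u => ?_⟩
    · simpa using h ![u, 0]
    · simpa using h ![0, u]

/-- Passing from the `k`-th root to the root of order `2 * k - r` with `r ≤ 1`. -/
theorem RepresentsRoot.chain_link {P : FreePencil l τ} {k r : ℕ} (hP : P.RepresentsRoot k)
    (hk : k ≠ 0) (hr : r ≤ 1) : (P.chain (link (1 - r))).RepresentsRoot (2 * k - r) := by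
  intro n S Y hS hY
  have hV (Z : Matrix (Fin n) (Fin n) ℝ) :
      (1 - r : ℝ) • (1 : Matrix (Fin n) (Fin n) ℝ) + (1 - (1 - r : ℝ)) • Z = Z ^ r := by
    interval_cases r <;> simp
  obtain ⟨s, rfl⟩ : ∃ s, k = s + r := ⟨k - r, by omega⟩
  have hm : 2 * (s + r) - r = s + (s + r) := by omega
  rw [hm]
  -- completing the square with respect to `R ^ s *ᵥ u`
  have hsq {R : Matrix (Fin n) (Fin n) ℝ} (hR : R.PosSemidef) (u v : Fin n → ℝ) :
      (R ^ s *ᵥ u + v) ⬝ᵥ (R ^ r *ᵥ (R ^ s *ᵥ u + v)) =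
        u ⬝ᵥ (R ^ (s + (s + r)) *ᵥ u) + u ⬝ᵥ (R ^ (s + r) *ᵥ v) + v ⬝ᵥ (R ^ (s + r) *ᵥ u) +
          v ⬝ᵥ (R ^ r *ᵥ v) := by
    have h₁ := (hR.pow s).isHermitian.mulVec_dotProduct
    simp only [mulVec_add, add_dotProduct, dotProduct_add, h₁, mulVec_mulVec]
    rw [pow_add _ s (s + r), pow_add, ← mul_assoc, ← (Commute.pow_pow_self R r s).eq]
    simp only [mul_assoc, ((Commute.refl R).pow_pow r s).eq]
    ring
  constructor
  · rintro ⟨hSY, hY'⟩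
    obtain ⟨Ws, hWs, hform⟩ := (hP n S S hS hS.isHermitian).1 ⟨by simpa using PosSemidef.zero, hS⟩
    have hW : ∀ t, ((![S ^ (s + r), S] : Fin 2 → _) t).IsHermitian := by
      intro t
      fin_cases t
      · exact (hS.pow _).isHermitian
      · exact hS.isHermitian
    refine ⟨Sum.elim Ws ![S ^ (s + r), S], by rintro (t | t); exacts [hWs t, hW t],
      (form_chain_nonneg_iff ..).2 ⟨by simpa using hform, ?_⟩⟩
    rw [Sum.elim_comp_inr, form_link_nonneg_iff _ hY hW]
    refine ⟨hSY, hY', hS.pow _, fun u v => ?_⟩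
    simp only [cons_val_zero, cons_val_one, hV]
    rw [← hsq hS]
    exact (hS.pow r).real_form_nonneg _
  · rintro ⟨W, hW, h⟩
    obtain ⟨hp, hl⟩ := (form_chain_nonneg_iff ..).1 h
    obtain ⟨hZY, hY', hW0, hblock⟩ := (form_link_nonneg_iff _ hY fun t => hW _).1 hl
    simp only [hV] at hZY hW0 hblock
    set Z := W (Sum.inr 1)
    obtain ⟨R, hR, hRW⟩ : ∃ R : Matrix (Fin n) (Fin n) ℝ, R.PosSemidef ∧
        R ^ (s + r) = W (Sum.inr 0) :=
      ⟨_, symPow_posSemidef hW0 _, symPow_one_div_pow hW0 hk⟩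
    rw [← hRW] at hp hblock
    have hRZ : (R - Z).PosSemidef :=
      ((hP n R Z hR (hW _)).2 ⟨W ∘ Sum.inl, fun t => hW _, hp⟩).1
    have hRZr (v : Fin n → ℝ) : v ⬝ᵥ (Z ^ r *ᵥ v) ≤ v ⬝ᵥ (R ^ r *ᵥ v) := by
      interval_cases r
      · simp
      · simpa [sub_mulVec] using hRZ.real_form_nonneg v
    have hRS : (S - R).PosSemidef := by
      refine posSemidef_sub_of_pow hR hS (m := s + (s + r)) (by omega) ?_
      refine ((hS.pow _).isHermitian.sub (hR.pow _).isHermitian).posSemidef_of_real_form fun u => ?_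
      have h₁ := hblock u (-(R ^ s *ᵥ u))
      have h₂ := hRZr (-(R ^ s *ᵥ u))
      have h₃ := hsq hR u (-(R ^ s *ᵥ u))
      rw [add_neg_cancel, zero_dotProduct] at h₃
      rw [sub_mulVec, dotProduct_sub]
      linarith
    refine ⟨?_, hY'⟩
    simpa using (hRS.add hRZ).add hZY

theorem exists_representsRoot (m : ℕ) (hm : 1 ≤ m) :
    ∃ (l τ : Type) (_ : Fintype l) (_ : Fintype τ) (_ : Nonempty l) (_ : Nonempty τ)
      (P : FreePencil l τ), P.RepresentsRoot m := by
  induction m using Nat.strong_induction_on with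
  | _ m ih =>
    obtain rfl | hm' := hm.eq_or_lt
    · exact ⟨_, _, inferInstance, inferInstance, inferInstance, inferInstance, interval,
        interval_representsRoot⟩
    · obtain ⟨l, τ, _, _, _, _, P, hP⟩ := ih ((m + 1) / 2) (by omega) (by omega)
      have hlink := hP.chain_link (r := 2 * ((m + 1) / 2) - m) (by omega) (by omega)
      rw [show 2 * ((m + 1) / 2) - (2 * ((m + 1) / 2) - m) = m by omega] at hlink
      exact ⟨_, _, inferInstance, inferInstance, inferInstance, inferInstance, _, hlink⟩

end FreePencil

open Kronecker in
/-- For every positive integer `m`, the hypograph of `X^{1/m}` has a free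
semidefinite representation: there are fixed real symmetric `ℓ × ℓ` matrices
`A₀, A₁, A₂, B₁, …, B_{g'}` (independent of `n`) such that for all `n ≥ 1`
and real symmetric `X ⪰ 0`, `Y`:  `X^{1/m} ⪰ Y ⪰ 0` iff there are real
symmetric `n × n` matrices `W₁, …, W_{g'}` making the linear pencil
`A₀ ⊗ I + A₁ ⊗ X + A₂ ⊗ Y + ∑ⱼ Bⱼ ⊗ Wⱼ` positive semidefinite. -/
theorem reciprocal_power_hypograph_free_sdr (m : ℕ) (hm : 1 ≤ m) :
    ∃ (l g' : ℕ), 1 ≤ l ∧ 1 ≤ g' ∧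
    ∃ (A₀ A₁ A₂ : Matrix (Fin l) (Fin l) ℝ) (B : Fin g' → Matrix (Fin l) (Fin l) ℝ),
      A₀.IsHermitian ∧ A₁.IsHermitian ∧ A₂.IsHermitian ∧
      (∀ j, (B j).IsHermitian) ∧
      ∀ (n : ℕ), 1 ≤ n →
        ∀ (X Y : Matrix (Fin n) (Fin n) ℝ), X.PosSemidef → Y.IsHermitian →
          (((symPow X (1 / (m : ℝ)) - Y).PosSemidef ∧ Y.PosSemidef)
            ↔
          (∃ W : Fin g' → Matrix (Fin n) (Fin n) ℝ,
            (∀ j, (W j).IsHermitian) ∧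
            (A₀ ⊗ₖ (1 : Matrix (Fin n) (Fin n) ℝ) + A₁ ⊗ₖ X + A₂ ⊗ₖ Y
              + ∑ j, B j ⊗ₖ W j).PosSemidef)) := by
  obtain ⟨l, τ, _, _, _, _, P, hP⟩ := FreePencil.exists_representsRoot m hm
  let e := Fintype.equivFin l
  let f := Fintype.equivFin τ
  let Q := P.reindex e f
  refine ⟨Fintype.card l, Fintype.card τ, Fintype.card_pos, Fintype.card_pos, Q.const, Q.fst,
    Q.snd, Q.aux, Q.const_herm, Q.fst_herm, Q.snd_herm, Q.aux_herm, fun n _ X Y hX hY => ?_⟩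
  have hroot := hP n _ Y (symPow_posSemidef hX (1 / (m : ℝ))) hY
  rw [symPow_one_div_pow hX (by omega)] at hroot
  rw [hroot]
  constructor
  · rintro ⟨W, hW, h⟩
    have hW' : ∀ t, ((W ∘ f.symm) t).IsHermitian := fun t => hW _
    refine ⟨W ∘ f.symm, hW',
      (Q.posSemidef_iff_form_nonneg hX.isHermitian hY hW').2 fun x => ?_⟩
    rw [FreePencil.form_reindex]
    simpa [Function.comp_assoc] using h (x ∘ e)
  · rintro ⟨W, hW, h⟩
    refine ⟨W ∘ f, fun t => hW _, fun x => ?_⟩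
    have := (Q.posSemidef_iff_form_nonneg hX.isHermitian hY hW).1 h (x ∘ e.symm)
    rw [FreePencil.form_reindex] at this
    simpa [Function.comp_assoc] using this
end

section
/- For a rational number q ∈ (0,1) with q ≠ 1/2, define f(q) := 2 − 1/q if 1/2 < q < 1, and f(q) := d(q)·q if 0 < q < 1/2, where d(q) is the smallest positive integer d with d·q ≥ 1/2. Then for every rational p ∈ (0,1) there exist an integer m ≥ 0 and rational numbers p₀, p₁, …, p_m, all lying in (0,1), with p₀ = p, p_m = 1/2, p_i ≠ 1/2 for every i < m, and p_{i+1} = f(p_i) for every i < m; i.e., iterating f starting from p reaches 1/2 in finitely many steps. -/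
/-- `y` is the successor of `x` under `q ↦ 2 - 1/q` (above `1/2`) and `q ↦ d(q)·q` (below). -/
def HalfStep (x y : ℚ) : Prop :=
  x ≠ 1 / 2 ∧
  (1 / 2 < x → y = 2 - 1 / x) ∧
  (x < 1 / 2 →
    ∃ d : ℕ, 0 < d ∧ 1 / 2 ≤ (d : ℚ) * x ∧
      (∀ d' : ℕ, 0 < d' → 1 / 2 ≤ (d' : ℚ) * x → d ≤ d') ∧
      y = (d : ℚ) * x)

/-- Some finite chain of `HalfStep`s inside `(0,1)` leads from `p` to `1/2`. -/
def ReachesHalf (p : ℚ) : Prop :=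
  ∃ (m : ℕ) (q : ℕ → ℚ),
    q 0 = p ∧ q m = 1 / 2 ∧ (∀ i ≤ m, 0 < q i ∧ q i < 1) ∧ ∀ i < m, HalfStep (q i) (q (i + 1))

theorem reachesHalf_half : ReachesHalf (1 / 2) :=
  ⟨0, fun _ => 1 / 2, rfl, rfl, fun _ _ => by norm_num, fun i hi => absurd hi i.not_lt_zero⟩

theorem ReachesHalf.of_step {x y : ℚ} (hx0 : 0 < x) (hx1 : x < 1) (h : HalfStep x y)
    (hy : ReachesHalf y) : ReachesHalf x := by
  obtain ⟨m, q, h0, hm, hq, hs⟩ := hy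
  refine ⟨m + 1, fun i => Nat.casesOn i x q, rfl, hm, ?_, ?_⟩
  · rintro (_ | i) hi
    · exact ⟨hx0, hx1⟩
    · exact hq i (by omega)
  · rintro (_ | i) hi
    · simpa [h0] using h
    · exact hs i (by omega)

theorem halfStep_of_half_lt {x : ℚ} (hx : 1 / 2 < x) : HalfStep x (2 - 1 / x) :=
  ⟨hx.ne', fun _ => rfl, fun h => absurd h hx.not_gt⟩

theorem exists_halfStep_of_lt_half {x : ℚ} (hx0 : 0 < x) (hx : x < 1 / 2) :
    ∃ d : ℕ, 0 < d ∧ 1 / 2 ≤ (d : ℚ) * x ∧ (d : ℚ) * x < 1 ∧ HalfStep x (d * x) := by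
  classical
  have hex : ∃ d : ℕ, 0 < d ∧ 1 / 2 ≤ (d : ℚ) * x := by
    obtain ⟨n, hn⟩ := exists_nat_ge (1 / 2 / x)
    have hn' : 1 / 2 ≤ (n : ℚ) * x := (div_le_iff₀ hx0).1 hn
    refine ⟨n, Nat.pos_of_ne_zero ?_, hn'⟩
    rintro rfl
    norm_num at hn'
  have hmin (d' : ℕ) (h : 0 < d') (h' : 1 / 2 ≤ (d' : ℚ) * x) : Nat.find hex ≤ d' :=
    Nat.find_min' hex ⟨h, h'⟩
  obtain ⟨hd, hdx⟩ := Nat.find_spec hex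
  generalize Nat.find hex = d at hmin hd hdx
  refine ⟨d, hd, hdx, ?_, hx.ne, fun h => absurd h hx.not_gt, fun _ => ⟨d, hd, hdx, hmin, rfl⟩⟩
  obtain ⟨k, rfl⟩ := Nat.exists_eq_succ_of_ne_zero hd.ne'
  have hk : (k : ℚ) * x < 1 / 2 := by
    by_contra! hk
    rcases k.eq_zero_or_pos with rfl | hk0
    · norm_num at hk
    · have := hmin k hk0 hk
      omega
  push_cast
  linarith

theorem reachesHalf_div (b : ℕ) : ∀ a : ℕ, 0 < a → a < b → ReachesHalf ((a : ℚ) / b) := by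
  induction b using Nat.strong_induction_on with
  | _ b ih =>
  intro a ha hab
  have hb : (0 : ℚ) < b := by exact_mod_cast ha.trans hab
  have of_half_le (c : ℕ) (hcb : c < b) (hc : (1 / 2 : ℚ) ≤ c / b) : ReachesHalf ((c : ℚ) / b) := by
    rcases hc.eq_or_lt with hc | hc
    · exact hc ▸ reachesHalf_half
    have hbc : b < 2 * c := by
      rw [lt_div_iff₀ hb] at hc
      have : (b : ℚ) < 2 * c := by linarith
      exact_mod_cast this
    have hc0 : (0 : ℚ) < c := by exact_mod_cast (by omega : 0 < c)
    have hcb' : (c : ℚ) < b := by exact_mod_cast hcb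
    refine .of_step (by positivity) ((div_lt_one hb).2 hcb') (halfStep_of_half_lt hc) ?_
    have h := ih c hcb (2 * c - b) (by omega) (by omega)
    rw [Nat.cast_sub hbc.le] at h
    convert h using 1
    push_cast
    field_simp
  rcases le_or_gt (1 / 2 : ℚ) (a / b) with h | h
  · exact of_half_le a hab h
  · have hx0 : (0 : ℚ) < a / b := div_pos (by exact_mod_cast ha) hb
    obtain ⟨d, -, hd, hd1, hstep⟩ := exists_halfStep_of_lt_half hx0 h
    refine .of_step hx0 (by linarith) hstep ?_
    have hda : (d : ℚ) * (a / b) = ((d * a : ℕ) : ℚ) / b := by push_cast; ring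
    rw [hda] at hd hd1 ⊢
    exact of_half_le _ (by exact_mod_cast (div_lt_one hb).1 hd1) hd

/-- For every rational `p ∈ (0,1)`, iterating the map
`q ↦ 2 - 1/q` (when `1/2 < q < 1`) and `q ↦ d(q)·q` (when `0 < q < 1/2`, with
`d(q)` the least positive integer `d` such that `d·q ≥ 1/2`) starting from `p`
reaches `1/2` in finitely many steps. -/
theorem chain_reaches_half (p : ℚ) (hp0 : 0 < p) (hp1 : p < 1) :
    ∃ (m : ℕ) (q : ℕ → ℚ),
      q 0 = p ∧
      q m = 1 / 2 ∧
      (∀ i ≤ m, 0 < q i ∧ q i < 1) ∧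
      ∀ i < m,
        q i ≠ 1 / 2 ∧
        (1 / 2 < q i → q (i + 1) = 2 - 1 / q i) ∧
        (q i < 1 / 2 →
          ∃ d : ℕ, 0 < d ∧ 1 / 2 ≤ (d : ℚ) * q i ∧
            (∀ d' : ℕ, 0 < d' → 1 / 2 ≤ (d' : ℚ) * q i → d ≤ d') ∧
            q (i + 1) = (d : ℚ) * q i) := by
  have hcast : ((p.num.toNat : ℚ)) = p.num := by
    exact_mod_cast Int.toNat_of_nonneg (Rat.num_nonneg.2 hp0.le)
  have hp : (p.num.toNat : ℚ) / p.den = p := by rw [hcast, Rat.num_div_den]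
  have hden : (0 : ℚ) < p.den := by exact_mod_cast p.den_pos
  have hlt : p.num.toNat < p.den := by
    rw [← hp, div_lt_one hden] at hp1
    exact_mod_cast hp1
  have hpos : 0 < p.num.toNat := by
    have := Rat.num_pos.2 hp0
    omega
  exact hp ▸ reachesHalf_div p.den p.num.toNat hpos hlt
end

section
/- Let p be a rational number with 1 < p < 2. For every n ≥ 1 and all real symmetric n×n matrices X and Y with X ⪰ 0, the following are equivalent: (i) X^p ⪯ Y; (ii) there exists a real symmetric n×n matrix Z such that the block matrix [[Y, X],[X, Z]] is positive semidefinite and X^{2−p} ⪰ Z ⪰ 0. -/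
open Matrix

/-- Powers of a positive semidefinite matrix with nonnegative exponents multiply by adding
exponents. -/
theorem symPow_mul_symPow {n : ℕ} {X : Matrix (Fin n) (Fin n) ℝ} (hX : X.PosSemidef)
    {a b : ℝ} (ha : 0 ≤ a) (hb : 0 ≤ b) :
    symPow X a * symPow X b = symPow X (a + b) := by
  have hU : star (hX.1.eigenvectorUnitary : Matrix (Fin n) (Fin n) ℝ) *
      (hX.1.eigenvectorUnitary : Matrix (Fin n) (Fin n) ℝ) = 1 :=
    Unitary.coe_star_mul_self _
  have hdiag : Matrix.diagonal (fun i => hX.1.eigenvalues i ^ (a + b)) =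
      Matrix.diagonal (fun i => hX.1.eigenvalues i ^ a) *
        Matrix.diagonal (fun i => hX.1.eigenvalues i ^ b) := by
    rw [Matrix.diagonal_mul_diagonal]
    congr 1
    funext i
    exact Real.rpow_add_of_nonneg (hX.eigenvalues_nonneg i) ha hb
  simp only [symPow, dif_pos hX.1, hdiag, Matrix.mul_assoc]
  rw [← Matrix.mul_assoc (star _) _ _, hU, Matrix.one_mul]

theorem symPow_one {n : ℕ} {X : Matrix (Fin n) (Fin n) ℝ} (hX : X.IsHermitian) :
    symPow X 1 = X := by
  conv_rhs => rw [hX.spectral_theorem]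
  rw [symPow, dif_pos hX]
  simp [Unitary.conjStarAlgAut_apply]

theorem conjTranspose_symPow {n : ℕ} (X : Matrix (Fin n) (Fin n) ℝ) (a : ℝ) :
    (symPow X a)ᴴ = symPow X a := by
  unfold symPow
  split_ifs with hX
  · simp [Matrix.star_eq_conjTranspose, Matrix.mul_assoc]
  · simp

/-- The Gram-type block matrix of two symmetric matrices is positive semidefinite. -/
theorem posSemidef_fromBlocks_mul {m : Type*} [Fintype m] {A B : Matrix m m ℝ}
    (hA : Aᴴ = A) (hB : Bᴴ = B) :
    (Matrix.fromBlocks (A * A) (A * B) (B * A) (B * B)).PosSemidef := by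
  have h := Matrix.posSemidef_self_mul_conjTranspose (Matrix.fromRows A B)
  rwa [Matrix.conjTranspose_fromRows_eq_fromCols_conjTranspose, hA, hB,
    Matrix.fromRows_mul_fromCols] at h

theorem posSemidef_fromBlocks_zero {m : Type*} [Fintype m] [DecidableEq m] {W : Matrix m m ℝ}
    (hW : W.PosSemidef) :
    (Matrix.fromBlocks W 0 0 (0 : Matrix m m ℝ)).PosSemidef := by
  have h := hW.mul_mul_conjTranspose_same (Matrix.fromRows (1 : Matrix m m ℝ) (0 : Matrix m m ℝ))
  rw [Matrix.conjTranspose_fromRows_eq_fromCols_conjTranspose, Matrix.fromRows_mul,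
    Matrix.fromRows_mul_fromCols] at h
  simpa using h

/-- Compressing a positive semidefinite block matrix along the columns `(1, -C)`. -/
theorem posSemidef_compression_of_fromBlocks {m : Type*} [Fintype m] [DecidableEq m]
    {Y X Z C : Matrix m m ℝ} (h : (Matrix.fromBlocks Y X X Z).PosSemidef) (hC : Cᴴ = C) :
    (Y - X * C - C * X + C * Z * C).PosSemidef := by
  have h' := h.mul_mul_conjTranspose_same (Matrix.fromCols (1 : Matrix m m ℝ) (-C))
  rw [Matrix.conjTranspose_fromCols_eq_fromRows_conjTranspose, Matrix.fromCols_mul_fromBlocks,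
    Matrix.fromCols_mul_fromRows] at h'
  convert h' using 1
  simp only [Matrix.conjTranspose_one, Matrix.conjTranspose_neg, hC]
  noncomm_ring

/-- Let `p` be rational with `1 < p < 2`.  For every `n ≥ 1` and real
symmetric `n × n` matrices `X ⪰ 0` and `Y`:  `X^p ⪯ Y` iff there is a real
symmetric `Z` with `[[Y, X], [X, Z]] ⪰ 0` and `X^{2-p} ⪰ Z ⪰ 0`. -/
theorem power_epigraph_sdr (p : ℚ) (hp1 : 1 < p) (hp2 : p < 2)
    (n : ℕ) (hn : 1 ≤ n)
    (X Y : Matrix (Fin n) (Fin n) ℝ) (hX : X.PosSemidef) (hY : Y.IsHermitian) :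
    (Y - symPow X (p : ℝ)).PosSemidef
      ↔
    (∃ Z : Matrix (Fin n) (Fin n) ℝ, Z.IsHermitian ∧
      (Matrix.fromBlocks Y X X Z).PosSemidef ∧
      (symPow X ((2 - p : ℚ) : ℝ) - Z).PosSemidef ∧ Z.PosSemidef) := by
  have hp1' : (1 : ℝ) < p := by exact_mod_cast hp1
  have hp2' : (p : ℝ) < 2 := by exact_mod_cast hp2
  push_cast
  have key : ∀ {a b : ℝ} (c : ℝ), 0 < a → 0 < b → a + b = c →
      symPow X a * symPow X b = symPow X c := by
    rintro a b _ ha hb rfl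
    exact symPow_mul_symPow hX ha.le hb.le
  have hone := symPow_one hX.1
  constructor
  · intro h
    have hB := posSemidef_fromBlocks_mul (conjTranspose_symPow X ((p : ℝ) / 2))
      (conjTranspose_symPow X (1 - (p : ℝ) / 2))
    rw [key (p : ℝ) (by linarith) (by linarith) (by ring),
      key 1 (by linarith) (by linarith) (by ring),
      key 1 (by linarith) (by linarith) (by ring),
      key (2 - (p : ℝ)) (by linarith) (by linarith) (by ring), hone] at hB
    have hZ : (symPow X (2 - (p : ℝ))).PosSemidef := by
      have hsq := Matrix.posSemidef_self_mul_conjTranspose (symPow X (1 - (p : ℝ) / 2))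
      rwa [conjTranspose_symPow,
        key (2 - (p : ℝ)) (by linarith) (by linarith) (by ring)] at hsq
    refine ⟨symPow X (2 - (p : ℝ)), hZ.1, ?_, ?_, hZ⟩
    · simpa [Matrix.fromBlocks_add] using (posSemidef_fromBlocks_zero h).add hB
    · simpa using Matrix.PosSemidef.zero
  · rintro ⟨Z, -, hB, hZ, -⟩
    set C := symPow X ((p : ℝ) - 1)
    have hC : Cᴴ = C := conjTranspose_symPow X _
    have hXC : X * C = symPow X p := by
      have h := key (p : ℝ) one_pos (sub_pos.2 hp1') (by ring)
      rwa [hone] at h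
    have hCX : C * X = symPow X p := by
      have h := key (p : ℝ) (sub_pos.2 hp1') one_pos (by ring)
      rwa [hone] at h
    have hCC : C * symPow X (2 - (p : ℝ)) * C = symPow X p := by
      rw [key 1 (by linarith) (by linarith) (by ring), hone, hXC]
    have hsum := (posSemidef_compression_of_fromBlocks hB hC).add
      (hZ.mul_mul_conjTranspose_same C)
    rw [hC, Matrix.mul_sub, Matrix.sub_mul, hCC, hXC, hCX] at hsum
    convert hsum using 1
    abel
end

section
/- Let p be a rational number with −1 < p < 0. For every n ≥ 1, every real symmetric positive definite n×n matrix X, and every real symmetric n×n matrix Y, the following are equivalent: (i) Y ⪰ X^p; (ii) Y is positive definite and there exists a real symmetric n×n matrix Z such that X^{−p} ⪰ Z ⪰ 0 and the block matrix [[Z, I_n],[I_n, Y]] is positive semidefinite. -/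
open Matrix

theorem symPow_posDef {n : ℕ} {X : Matrix (Fin n) (Fin n) ℝ} (hX : X.PosDef) (r : ℝ) :
    (symPow X r).PosDef := by
  rw [symPow, dif_pos hX.1]
  have hD : (Matrix.diagonal fun i => hX.1.eigenvalues i ^ r).PosDef :=
    Matrix.PosDef.diagonal fun i => Real.rpow_pos_of_pos (hX.eigenvalues_pos i) r
  refine hD.mul_mul_conjTranspose_same ?_
  rw [Matrix.vecMul_injective_iff_isUnit]
  exact (Unitary.toUnits hX.1.eigenvectorUnitary).isUnit

theorem symPow_neg_mul_symPow {n : ℕ} {X : Matrix (Fin n) (Fin n) ℝ} (hX : X.PosDef) (r : ℝ) :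
    symPow X (-r) * symPow X r = 1 := by
  rw [symPow, symPow, dif_pos hX.1, dif_pos hX.1]
  set U := hX.1.eigenvectorUnitary
  have hD : (Matrix.diagonal fun i => hX.1.eigenvalues i ^ (-r)) *
      (Matrix.diagonal fun i => hX.1.eigenvalues i ^ r) = 1 := by
    rw [Matrix.diagonal_mul_diagonal, ← Matrix.diagonal_one]
    congr 1
    funext i
    rw [← Real.rpow_add (hX.eigenvalues_pos i), neg_add_cancel, Real.rpow_zero]
  calc _ = (U : Matrix (Fin n) (Fin n) ℝ) * ((Matrix.diagonal fun i => hX.1.eigenvalues i ^ (-r)) *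
          ((star (U : Matrix (Fin n) (Fin n) ℝ) * (U : Matrix (Fin n) (Fin n) ℝ)) *
          (Matrix.diagonal fun i => hX.1.eigenvalues i ^ r))) *
          star (U : Matrix (Fin n) (Fin n) ℝ) := by simp only [Matrix.mul_assoc]
    _ = 1 := by
      rw [Unitary.coe_star_mul_self, Matrix.one_mul, hD, Matrix.mul_one, ← Unitary.coe_star,
        Unitary.coe_mul_star_self]

theorem fromBlocks_symPow_neg_posSemidef_iff {n : ℕ} {X : Matrix (Fin n) (Fin n) ℝ}
    (hX : X.PosDef) (Y : Matrix (Fin n) (Fin n) ℝ) (r : ℝ) :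
    (Matrix.fromBlocks (symPow X (-r)) 1 1 Y).PosSemidef ↔ (Y - symPow X r).PosSemidef := by
  have hW := symPow_posDef hX (-r)
  let := hW.isUnit.invertible
  have h := Matrix.PosDef.fromBlocks₁₁ (1 : Matrix (Fin n) (Fin n) ℝ) Y hW
  rwa [Matrix.conjTranspose_one, Matrix.one_mul, Matrix.mul_one,
    Matrix.inv_eq_right_inv (symPow_neg_mul_symPow hX r)] at h

theorem Matrix.PosSemidef.fromBlocks_zero {m n : Type*} [Fintype m] [Fintype n] [DecidableEq m]
    {A : Matrix m m ℝ} (hA : A.PosSemidef) :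
    (Matrix.fromBlocks A 0 0 (0 : Matrix n n ℝ)).PosSemidef := by
  have h := hA.conjTranspose_mul_mul_same (Matrix.fromCols (1 : Matrix m m ℝ) (0 : Matrix m n ℝ))
  rwa [Matrix.conjTranspose_fromCols_eq_fromRows_conjTranspose, Matrix.fromRows_mul,
    Matrix.fromRows_mul_fromCols, Matrix.conjTranspose_one, Matrix.conjTranspose_zero,
    Matrix.one_mul, Matrix.mul_one, Matrix.mul_zero, Matrix.zero_mul, Matrix.zero_mul,
    Matrix.zero_mul] at h

/-- Let `p` be rational with `-1 < p < 0`.  For every `n ≥ 1`, every real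
symmetric positive definite `X` and every real symmetric `Y`:  `Y ⪰ X^p` iff
`Y` is positive definite and there is a real symmetric `Z` with
`X^{-p} ⪰ Z ⪰ 0` and `[[Z, I], [I, Y]] ⪰ 0`. -/
theorem negative_power_epigraph_sdr (p : ℚ) (hp1 : -1 < p) (hp2 : p < 0)
    (n : ℕ) (hn : 1 ≤ n)
    (X Y : Matrix (Fin n) (Fin n) ℝ) (hX : X.PosDef) (hY : Y.IsHermitian) :
    (Y - symPow X (p : ℝ)).PosSemidef
      ↔
    (Y.PosDef ∧
      ∃ Z : Matrix (Fin n) (Fin n) ℝ, Z.IsHermitian ∧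
        (symPow X ((-p : ℚ) : ℝ) - Z).PosSemidef ∧ Z.PosSemidef ∧
        (Matrix.fromBlocks Z 1 1 Y).PosSemidef) := by
  rw [Rat.cast_neg]
  constructor
  · intro h
    have hW := symPow_posDef hX (-(p : ℝ))
    refine ⟨?_, _, hW.1, ?_, hW.posSemidef, (fromBlocks_symPow_neg_posSemidef_iff hX Y _).2 h⟩
    · simpa using Matrix.PosDef.posSemidef_add h (symPow_posDef hX p)
    · rw [sub_self]
      exact Matrix.PosSemidef.zero
  · rintro ⟨-, Z, -, hWZ, -, hB⟩
    rw [← fromBlocks_symPow_neg_posSemidef_iff hX]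
    simpa [Matrix.fromBlocks_add] using hB.add (hWZ.fromBlocks_zero (n := Fin n))
end

section
/- For every rational number p ∈ [1,2], the epigraph of the matrix power function X^p admits a free semidefinite representation: there exist positive integers ℓ and g′ and real symmetric ℓ×ℓ matrices A₀, A₁, A₂, B₁, …, B_{g′} (independent of n) such that for every n ≥ 1 and all real symmetric n×n matrices X, Y with X ⪰ 0, one has X^p ⪯ Y if and only if there exist real symmetric n×n matrices W₁, …, W_{g′} with A₀ ⊗ I_n + A₁ ⊗ X + A₂ ⊗ Y + Σ_{j=1}^{g′} B_j ⊗ W_j positive semidefinite. -/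
open Matrix

/-- A Hermitian form is bounded by `c` times a positive diagonal form as soon as all generalized
eigenvalues are at most `c`. -/
lemma quadForm_le_of_generalizedEigenvalue_le {ι : Type*} [Fintype ι] [DecidableEq ι]
    {T : Matrix ι ι ℝ} (hT : T.IsHermitian) {w : ι → ℝ} (hw : ∀ i, 0 < w i) {c : ℝ}
    (h : ∀ (μ : ℝ) (v : ι → ℝ), v ≠ 0 → (∀ i, (T *ᵥ v) i = μ * (w i * v i)) → μ ≤ c)
    (x : ι → ℝ) : x ⬝ᵥ T *ᵥ x ≤ c * ∑ i, w i * x i ^ 2 := by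
  set e : ι → ℝ := fun i => (√(w i))⁻¹ with he
  have hwpos : ∀ i, 0 < √(w i) := fun i => Real.sqrt_pos.2 (hw i)
  have hww : ∀ i, √(w i) * √(w i) = w i := fun i => Real.mul_self_sqrt (hw i).le
  set S : Matrix ι ι ℝ := c • (1 : Matrix ι ι ℝ) - diagonal e * T * diagonal e with hS
  have hSH : S.IsHermitian := by
    have h1 : (diagonal e * T * diagonal e).IsHermitian := by
      have := isHermitian_mul_mul_conjTranspose (diagonal e) hT
      simpa [diagonal_conjTranspose] using this
    refine IsHermitian.sub ?_ h1
    simp [IsHermitian]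
  have hmul : ∀ (u : ι → ℝ) (i : ι),
      (S *ᵥ u) i = c * u i - e i * (T *ᵥ (fun k => e k * u k)) i := by
    intro u i
    have : (diagonal e *ᵥ u) = fun k => e k * u k := by
      ext k; simp [mulVec_diagonal]
    simp only [hS, sub_mulVec, smul_mulVec, one_mulVec, ← mulVec_mulVec, this, Pi.sub_apply,
      Pi.smul_apply, smul_eq_mul, mulVec_diagonal]
  have hpsd : S.PosSemidef := by
    rw [hSH.posSemidef_iff_eigenvalues_nonneg]
    intro j
    have hj := hSH.mulVec_eigenvectorBasis j
    set u : ι → ℝ := ⇑(hSH.eigenvectorBasis j) with hu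
    have hu0 : u ≠ 0 := by
      intro h0
      apply hSH.eigenvectorBasis.orthonormal.ne_zero j
      ext i
      exact congrFun h0 i
    have key := h (c - hSH.eigenvalues j) (fun k => e k * u k) ?_ ?_
    · simpa using key
    · intro h0
      apply hu0
      ext i
      have := congrFun h0 i
      have hne : e i ≠ 0 := inv_ne_zero (hwpos i).ne'
      simpa [hne] using this
    · intro i
      have h1 := hmul u i
      rw [hj] at h1
      simp only [Pi.smul_apply, smul_eq_mul] at h1
      have h2 : e i * (T *ᵥ (fun k => e k * u k)) i = (c - hSH.eigenvalues j) * u i := by linarith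
      have h3 : √(w i) * e i = 1 := mul_inv_cancel₀ (hwpos i).ne'
      calc (T *ᵥ (fun k => e k * u k)) i
          = (√(w i) * e i) * (T *ᵥ (fun k => e k * u k)) i := by rw [h3, one_mul]
        _ = √(w i) * ((c - hSH.eigenvalues j) * u i) := by rw [mul_assoc, h2]
        _ = (√(w i) * e i) * √(w i) * ((c - hSH.eigenvalues j) * u i) := by rw [h3, one_mul]
        _ = (√(w i) * √(w i)) * e i * ((c - hSH.eigenvalues j) * u i) := by ring
        _ = _ := by rw [hww]; ring
  have hx := hpsd.dotProduct_mulVec_nonneg (fun i => √(w i) * x i)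
  have hxe : (fun k => e k * (√(w k) * x k)) = x := by
    ext k
    rw [← mul_assoc, inv_mul_cancel₀ (hwpos k).ne', one_mul]
  simp only [star_trivial, dotProduct] at hx
  have hterm : ∀ i, √(w i) * x i * (S *ᵥ fun i => √(w i) * x i) i
      = c * (w i * x i ^ 2) - x i * (T *ᵥ x) i := by
    intro i
    rw [hmul, hxe]
    have h3 : √(w i) * e i = 1 := mul_inv_cancel₀ (hwpos i).ne'
    linear_combination (c * x i ^ 2) * hww i - x i * (T *ᵥ x) i * h3
  simp only [hterm, Finset.sum_sub_distrib, ← Finset.mul_sum] at hx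
  simpa [dotProduct] using hx

/-- If a `2 × 2` block matrix with off-diagonal block `T` is positive semidefinite and its
diagonal blocks are bounded by `a ^ 2 • D ^ j` and `b ^ 2 • D ^ (j + 2)`, then
`T ⪯ (a * b) • D ^ (j + 1)`. -/
lemma quadForm_le_of_block {ι : Type*} [Fintype ι] [DecidableEq ι]
    {P T Q : Matrix ι ι ℝ} (hT : T.IsHermitian) {d : ι → ℝ} (hd : ∀ i, 0 < d i) {j : ℕ}
    {a b : ℝ} (ha : 0 < a) (hb : 0 < b)
    (hblock : ∀ x y : ι → ℝ, 0 ≤ x ⬝ᵥ P *ᵥ x + 2 * (x ⬝ᵥ T *ᵥ y) + y ⬝ᵥ Q *ᵥ y)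
    (hP : ∀ x : ι → ℝ, x ⬝ᵥ P *ᵥ x ≤ a ^ 2 * ∑ i, d i ^ j * x i ^ 2)
    (hQ : ∀ x : ι → ℝ, x ⬝ᵥ Q *ᵥ x ≤ b ^ 2 * ∑ i, d i ^ (j + 2) * x i ^ 2) (x : ι → ℝ) :
    x ⬝ᵥ T *ᵥ x ≤ a * b * ∑ i, d i ^ (j + 1) * x i ^ 2 := by
  refine quadForm_le_of_generalizedEigenvalue_le hT (fun i => pow_pos (hd i) _) ?_ x
  intro μ v hv hμ
  set N := ∑ i, d i ^ (j + 2) * v i ^ 2 with hN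
  have hNpos : 0 < N := by
    obtain ⟨i, hi⟩ := Function.ne_iff.1 hv
    refine Finset.sum_pos' (fun k _ => ?_) ⟨i, Finset.mem_univ i, ?_⟩
    · have := hd k; positivity
    · have := hd i
      have : v i ≠ 0 := hi
      positivity
  have h1 := hblock (fun i => -(b / a) * (d i * v i)) v
  have h2 := hP (fun i => -(b / a) * (d i * v i))
  have h3 := hQ v
  have e1 : ∑ i, d i ^ j * (-(b / a) * (d i * v i)) ^ 2 = (b / a) ^ 2 * N := by
    rw [hN, Finset.mul_sum]
    exact Finset.sum_congr rfl fun i _ => by ring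
  have e2 : (fun i => -(b / a) * (d i * v i)) ⬝ᵥ T *ᵥ v = -(b / a) * (μ * N) := by
    rw [hN, Finset.mul_sum, Finset.mul_sum]
    exact Finset.sum_congr rfl fun i _ => by rw [hμ]; ring
  rw [e1] at h2
  rw [e2] at h1
  have h4 : a ^ 2 * ((b / a) ^ 2 * N) = b ^ 2 * N := by field_simp
  have h5 : 0 ≤ 2 * ((b / a) * N) * (a * b - μ) := by
    have : (b / a) * (a * b) = b ^ 2 := by field_simp
    nlinarith
  have h6 : 0 < 2 * ((b / a) * N) := by positivity
  have := nonneg_of_mul_nonneg_right h5 h6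
  linarith

/-- Every quadratic form is bounded by a multiple of a given positive diagonal form. -/
lemma exists_quadForm_le {ι : Type*} [Fintype ι] (T : Matrix ι ι ℝ) {w : ι → ℝ}
    (hw : ∀ i, 0 < w i) :
    ∃ K : ℝ, ∀ x : ι → ℝ, x ⬝ᵥ T *ᵥ x ≤ K * ∑ i, w i * x i ^ 2 := by
  refine ⟨∑ a, ∑ b, |T a b| * ((w a)⁻¹ + (w b)⁻¹), fun x => ?_⟩
  have hx : ∀ a, x a ^ 2 ≤ (w a)⁻¹ * ∑ i, w i * x i ^ 2 := by
    intro a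
    rw [le_inv_mul_iff₀ (hw a)]
    exact Finset.single_le_sum (f := fun i => w i * x i ^ 2)
      (fun i _ => mul_nonneg (hw i).le (sq_nonneg _)) (Finset.mem_univ a)
  simp only [dotProduct, mulVec, Finset.sum_mul]
  refine Finset.sum_le_sum fun a _ => ?_
  rw [Finset.mul_sum]
  refine Finset.sum_le_sum fun b _ => ?_
  have h1 : x a * (T a b * x b) ≤ |T a b| * (x a ^ 2 + x b ^ 2) := by
    have h2 : x a * (T a b * x b) ≤ |T a b| * (|x a| * |x b|) := by
      refine (le_abs_self _).trans (le_of_eq ?_)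
      rw [abs_mul, abs_mul]; ring
    refine h2.trans (mul_le_mul_of_nonneg_left ?_ (abs_nonneg _))
    nlinarith [sq_nonneg (|x a| - |x b|), sq_abs (x a), sq_abs (x b), sq_nonneg (x a),
      sq_nonneg (x b)]
  rw [mul_assoc, add_mul]
  exact h1.trans (mul_le_mul_of_nonneg_left (add_le_add (hx a) (hx b)) (abs_nonneg _))

/-- A matrix sequence that is geometrically midpoint concave and bounded by `1` and `D ^ m` at the
ends is bounded by `D ^ j` throughout, for a positive diagonal `D`. -/
lemma chain_quadForm_le_of_pos {ι : Type*} [Fintype ι] [DecidableEq ι] {m : ℕ}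
    {T : ℕ → Matrix ι ι ℝ} (hT : ∀ j, (T j).IsHermitian) {d : ι → ℝ} (hd : ∀ i, 0 < d i)
    (h0 : ∀ x : ι → ℝ, x ⬝ᵥ T 0 *ᵥ x ≤ ∑ i, x i ^ 2)
    (hm : ∀ x : ι → ℝ, x ⬝ᵥ T m *ᵥ x ≤ ∑ i, d i ^ m * x i ^ 2)
    (hchain : ∀ j, j + 2 ≤ m → ∀ x y : ι → ℝ,
      0 ≤ x ⬝ᵥ T j *ᵥ x + 2 * (x ⬝ᵥ T (j + 1) *ᵥ y) + y ⬝ᵥ T (j + 2) *ᵥ y)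
    {j : ℕ} (hj : j ≤ m) (x : ι → ℝ) :
    x ⬝ᵥ T j *ᵥ x ≤ ∑ i, d i ^ j * x i ^ 2 := by
  have hsum : ∀ (j : ℕ) (x : ι → ℝ), 0 ≤ ∑ i, d i ^ j * x i ^ 2 := fun j x =>
    Finset.sum_nonneg fun i _ => mul_nonneg (pow_nonneg (hd i).le _) (sq_nonneg _)
  choose K hK using fun j => exists_quadForm_le (T j) (w := fun i => d i ^ j)
    (fun i => pow_pos (hd i) _)
  set s : ℝ := ∑ j ∈ Finset.range (m + 1), |K j| with hs
  have hs0 : 0 ≤ s := Finset.sum_nonneg fun _ _ => abs_nonneg _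
  set φ : ℕ → ℝ := fun j => (j : ℝ) * (m - j) with hφ
  have hends : ∀ t : ℝ, ∀ j, j = 0 ∨ j = m → ∀ x : ι → ℝ,
      x ⬝ᵥ T j *ᵥ x ≤ Real.exp (t * φ j) * ∑ i, d i ^ j * x i ^ 2 := by
    rintro t j (rfl | rfl) x
    · simpa [hφ] using h0 x
    · simpa [hφ] using hm x
  set r : ℝ := 1 - ((m : ℝ) ^ 2 + 1)⁻¹ with hr
  have hmpos : (0 : ℝ) < (m : ℝ) ^ 2 + 1 := by positivity
  have hr0 : 0 ≤ r := by
    rw [hr, sub_nonneg]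
    exact inv_le_one_of_one_le₀ (by nlinarith [sq_nonneg (m : ℝ)])
  have hr1 : r < 1 := by
    rw [hr]; linarith [inv_pos.2 hmpos]
  have hiter : ∀ N : ℕ, ∀ j ≤ m, ∀ x : ι → ℝ,
      x ⬝ᵥ T j *ᵥ x ≤ Real.exp (s * r ^ N * φ j) * ∑ i, d i ^ j * x i ^ 2 := by
    intro N
    induction N with
    | zero =>
      intro j hj x
      by_cases hj' : j = 0 ∨ j = m
      · exact hends _ j hj' x
      · push Not at hj'
        have hφ1 : 1 ≤ φ j := by
          have h1 : (1 : ℝ) ≤ j := by exact_mod_cast Nat.one_le_iff_ne_zero.2 hj'.1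
          have h2 : (j : ℝ) + 1 ≤ m := by exact_mod_cast lt_of_le_of_ne hj hj'.2
          simp only [hφ]
          nlinarith
        refine (hK j x).trans (mul_le_mul_of_nonneg_right ?_ (hsum j x))
        have h3 : |K j| ≤ s := Finset.single_le_sum (f := fun j => |K j|)
          (fun _ _ => abs_nonneg _) (Finset.mem_range.2 (Nat.lt_succ_of_le hj))
        have h4 := Real.add_one_le_exp (s * r ^ 0 * φ j)
        have h5 := le_abs_self (K j)
        rw [pow_zero, mul_one] at *
        nlinarith
    | succ N ih =>
      intro j hj x
      by_cases hj' : j = 0 ∨ j = m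
      · exact hends _ j hj' x
      · push Not at hj'
        obtain ⟨j, rfl⟩ := Nat.exists_eq_succ_of_ne_zero hj'.1
        have hj2 : j + 2 ≤ m := by have := hj'.2; simp only [Nat.succ_eq_add_one] at *; omega
        set t := s * r ^ N with ht
        have ht0 : 0 ≤ t := mul_nonneg hs0 (pow_nonneg hr0 _)
        have hsq : ∀ u : ℝ, Real.exp (u / 2) ^ 2 = Real.exp u := by
          intro u
          rw [← Real.exp_nat_mul]; congr 1; push_cast; ring
        have key := quadForm_le_of_block (hT (j + 1)) hd (j := j)
          (Real.exp_pos (t * φ j / 2)) (Real.exp_pos (t * φ (j + 2) / 2)) (hchain j hj2)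
          (by rw [hsq]; exact ih j (by omega)) (by rw [hsq]; exact ih (j + 2) hj2) x
        refine key.trans (mul_le_mul_of_nonneg_right ?_ (hsum _ x))
        rw [← Real.exp_add, Real.exp_le_exp]
        have hφle : φ (j + 1) ≤ (m : ℝ) ^ 2 + 1 := by
          have : (j : ℝ) + 2 ≤ m := by exact_mod_cast hj2
          have : (0 : ℝ) ≤ j := Nat.cast_nonneg j
          simp only [hφ]; push_cast
          nlinarith
        have h6 : φ j + φ (j + 2) = 2 * φ (j + 1) - 2 := by
          simp only [hφ]; push_cast; ring
        have h7 : ((m : ℝ) ^ 2 + 1)⁻¹ * φ (j + 1) ≤ 1 := by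
          rw [inv_mul_le_iff₀ hmpos, mul_one]; exact hφle
        have h8 : t * φ j / 2 + t * φ (j + 2) / 2 = t * (φ (j + 1) - 1) := by
          linear_combination t / 2 * h6
        have h9 : s * r ^ (N + 1) * φ (j + 1) = t * (r * φ (j + 1)) := by rw [ht]; ring
        rw [h8, Nat.succ_eq_add_one, h9]
        refine mul_le_mul_of_nonneg_left ?_ ht0
        rw [hr]; linarith
  have hlim : Filter.Tendsto
      (fun N : ℕ => Real.exp (s * r ^ N * φ j) * ∑ i, d i ^ j * x i ^ 2) Filter.atTop
      (nhds (Real.exp (s * 0 * φ j) * ∑ i, d i ^ j * x i ^ 2)) := by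
    refine Filter.Tendsto.mul_const _ ?_
    refine (Real.continuous_exp.tendsto _).comp ?_
    exact ((tendsto_pow_atTop_nhds_zero_of_lt_one hr0 hr1).const_mul s).mul_const _
  have := ge_of_tendsto' hlim fun N => hiter N j hj x
  simpa using this

/-- The version of `chain_quadForm_le_of_pos` for a nonnegative diagonal matrix. -/
lemma chain_quadForm_le {ι : Type*} [Fintype ι] [DecidableEq ι] {m : ℕ}
    {T : ℕ → Matrix ι ι ℝ} (hT : ∀ j, (T j).IsHermitian) {d : ι → ℝ} (hd : ∀ i, 0 ≤ d i)
    (h0 : ∀ x : ι → ℝ, x ⬝ᵥ T 0 *ᵥ x ≤ ∑ i, x i ^ 2)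
    (hm : ∀ x : ι → ℝ, x ⬝ᵥ T m *ᵥ x ≤ ∑ i, d i ^ m * x i ^ 2)
    (hchain : ∀ j, j + 2 ≤ m → ∀ x y : ι → ℝ,
      0 ≤ x ⬝ᵥ T j *ᵥ x + 2 * (x ⬝ᵥ T (j + 1) *ᵥ y) + y ⬝ᵥ T (j + 2) *ᵥ y)
    {j : ℕ} (hj : j ≤ m) (x : ι → ℝ) :
    x ⬝ᵥ T j *ᵥ x ≤ ∑ i, d i ^ j * x i ^ 2 := by
  have hlim : Filter.Tendsto (fun ε : ℝ => ∑ i, (d i + ε) ^ j * x i ^ 2)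
      (nhdsWithin 0 (Set.Ioi 0)) (nhds (∑ i, (d i + 0) ^ j * x i ^ 2)) := by
    have : Continuous fun ε : ℝ => ∑ i, (d i + ε) ^ j * x i ^ 2 := by fun_prop
    exact (this.tendsto 0).mono_left nhdsWithin_le_nhds
  have := ge_of_tendsto hlim (b := x ⬝ᵥ T j *ᵥ x) ?_
  · simpa using this
  · filter_upwards [self_mem_nhdsWithin] with ε hε
    have hε : 0 < ε := hε
    refine chain_quadForm_le_of_pos hT (fun i => by linarith [hd i]) h0 (fun y => ?_) hchain hj x
    refine (hm y).trans (Finset.sum_le_sum fun i _ => ?_)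
    have := hd i
    gcongr
    linarith

lemma dotProduct_unitary_diagonal_mulVec {ι : Type*} [Fintype ι] [DecidableEq ι]
    (U : Matrix ι ι ℝ) (w x y : ι → ℝ) :
    x ⬝ᵥ (U * diagonal w * star U) *ᵥ y = ∑ i, w i * ((star U *ᵥ x) i * (star U *ᵥ y) i) := by
  have h : x ᵥ* U = star U *ᵥ x := by
    rw [star_eq_conjTranspose, conjTranspose_eq_transpose_of_trivial, mulVec_transpose]
  rw [← mulVec_mulVec, ← mulVec_mulVec, dotProduct_mulVec, h]
  simp only [dotProduct, mulVec_diagonal]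
  exact Finset.sum_congr rfl fun i _ => by ring

lemma dotProduct_star_mul_mul_mulVec {ι : Type*} [Fintype ι]
    (U T : Matrix ι ι ℝ) (x y : ι → ℝ) :
    x ⬝ᵥ (star U * T * U) *ᵥ y = (U *ᵥ x) ⬝ᵥ T *ᵥ (U *ᵥ y) := by
  have h : x ᵥ* star U = U *ᵥ x := by
    rw [star_eq_conjTranspose, conjTranspose_eq_transpose_of_trivial, vecMul_transpose]
  rw [← mulVec_mulVec, ← mulVec_mulVec, dotProduct_mulVec, h]

lemma isHermitian_unitary_diagonal {ι : Type*} [Fintype ι] [DecidableEq ι]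
    (U : Matrix ι ι ℝ) (w : ι → ℝ) : (U * diagonal w * star U).IsHermitian :=
  isHermitian_mul_mul_conjTranspose U (isHermitian_diagonal w)

/-- For `X = U D ^ m U*` with `D` nonnegative diagonal, the inequality `X ^ (2 - k / m) ⪯ Y` is
witnessed by a matrix sequence standing for `1, X ^ (1 / m), …, X ^ (m / m)`. -/
lemma epigraph_iff_exists_chain {ι : Type*} [Fintype ι] [DecidableEq ι] {U : Matrix ι ι ℝ}
    (hU : star U * U = 1) {s : ι → ℝ} (hs : ∀ i, 0 ≤ s i) {k m : ℕ} (hk : k ≤ m)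
    {Y : Matrix ι ι ℝ} (hY : Y.IsHermitian) :
    (Y - U * diagonal (fun i => s i ^ (2 * m - k)) * star U).PosSemidef ↔
      ∃ T : ℕ → Matrix ι ι ℝ, (∀ j, (T j).IsHermitian) ∧
        (∀ x : ι → ℝ, x ⬝ᵥ T 0 *ᵥ x ≤ x ⬝ᵥ x) ∧
        (∀ x : ι → ℝ, x ⬝ᵥ T m *ᵥ x ≤
          x ⬝ᵥ (U * diagonal (fun i => s i ^ m) * star U) *ᵥ x) ∧
        (∀ j, j + 2 ≤ m → ∀ x y : ι → ℝ,
          0 ≤ x ⬝ᵥ T j *ᵥ x + 2 * (x ⬝ᵥ T (j + 1) *ᵥ y) + y ⬝ᵥ T (j + 2) *ᵥ y) ∧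
        (∀ x y : ι → ℝ, 0 ≤ x ⬝ᵥ Y *ᵥ x +
          2 * (x ⬝ᵥ (U * diagonal (fun i => s i ^ m) * star U) *ᵥ y) + y ⬝ᵥ T k *ᵥ y) := by
  have hU' : U * star U = 1 := mul_eq_one_comm.1 hU
  obtain ⟨e, rfl⟩ := Nat.exists_eq_add_of_le hk
  have hexp : 2 * (k + e) - k = k + 2 * e := by omega
  rw [hexp]
  constructor
  · intro h
    refine ⟨fun j => U * diagonal (fun i => s i ^ j) * star U,
      fun j => isHermitian_unitary_diagonal _ _, fun x => ?_, fun x => le_rfl,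
      fun j hj x y => ?_, fun x y => ?_⟩
    · simp [hU']
    · simp only [dotProduct_unitary_diagonal_mulVec]
      rw [Finset.mul_sum, ← Finset.sum_add_distrib, ← Finset.sum_add_distrib]
      refine Finset.sum_nonneg fun i _ => ?_
      have := mul_nonneg (pow_nonneg (hs i) j)
        (sq_nonneg ((star U *ᵥ x) i + s i * (star U *ᵥ y) i))
      refine this.trans_eq ?_
      ring
    · have h1 := h.dotProduct_mulVec_nonneg x
      rw [star_trivial, sub_mulVec, dotProduct_sub, sub_nonneg] at h1
      refine le_trans ?_ (add_le_add_left (add_le_add_left h1 _) _)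
      simp only [dotProduct_unitary_diagonal_mulVec]
      rw [Finset.mul_sum, ← Finset.sum_add_distrib, ← Finset.sum_add_distrib]
      refine Finset.sum_nonneg fun i _ => ?_
      have := mul_nonneg (pow_nonneg (hs i) k)
        (sq_nonneg (s i ^ e * (star U *ᵥ x) i + (star U *ᵥ y) i))
      refine this.trans_eq ?_
      ring
  · rintro ⟨T, hT, h0, hm, hchain, hepi⟩
    have hcancel : ∀ x : ι → ℝ, star U *ᵥ (U *ᵥ x) = x := fun x => by
      rw [mulVec_mulVec, hU, one_mulVec]
    have hcancel' : ∀ x : ι → ℝ, U *ᵥ (star U *ᵥ x) = x := fun x => by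
      rw [mulVec_mulVec, hU', one_mulVec]
    have hnorm : ∀ x : ι → ℝ, (U *ᵥ x) ⬝ᵥ (U *ᵥ x) = ∑ i, x i ^ 2 := fun x => by
      have := dotProduct_star_mul_mul_mulVec U 1 x x
      rw [mul_one, hU, one_mulVec, one_mulVec] at this
      rw [← this, dotProduct]
      exact Finset.sum_congr rfl fun i _ => by ring
    have key := chain_quadForm_le (T := fun j => star U * T j * U) (m := k + e)
      (fun j => isHermitian_conjTranspose_mul_mul U (hT j)) hs
      (fun x => by
        rw [dotProduct_star_mul_mul_mulVec, ← hnorm]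
        exact h0 _)
      (fun x => by
        rw [dotProduct_star_mul_mul_mulVec]
        refine (hm _).trans_eq ?_
        rw [dotProduct_unitary_diagonal_mulVec, hcancel]
        exact Finset.sum_congr rfl fun i _ => by ring)
      (fun j hj x y => by
        simp only [dotProduct_star_mul_mul_mulVec]
        exact hchain j hj _ _) hk
    refine PosSemidef.of_dotProduct_mulVec_nonneg
      (hY.sub (isHermitian_unitary_diagonal _ _)) fun x => ?_
    rw [star_trivial, sub_mulVec, dotProduct_sub, dotProduct_unitary_diagonal_mulVec]
    set z := star U *ᵥ x with hz
    have h1 := hepi x (U *ᵥ fun i => -(s i ^ e * z i))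
    have h2 := key (fun i => -(s i ^ e * z i))
    rw [dotProduct_star_mul_mul_mulVec] at h2
    rw [dotProduct_unitary_diagonal_mulVec, hcancel, ← hz] at h1
    have h3 : ∑ i, s i ^ (k + e) * (z i * -(s i ^ e * z i))
        = -∑ i, s i ^ (k + 2 * e) * (z i * z i) := by
      rw [← Finset.sum_neg_distrib]
      exact Finset.sum_congr rfl fun i _ => by ring
    have h4 : ∑ i, s i ^ k * (-(s i ^ e * z i)) ^ 2
        = ∑ i, s i ^ (k + 2 * e) * (z i * z i) :=
      Finset.sum_congr rfl fun i _ => by ring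
    rw [h3] at h1
    rw [h4] at h2
    linarith

open Kronecker in
lemma dotProduct_blockDiagonal_kronecker_mulVec {β κ ι : Type*} [Fintype β] [DecidableEq β]
    [Fintype κ] [Fintype ι] (M : β → Matrix κ κ ℝ) (N : Matrix ι ι ℝ)
    (z : (κ × β) × ι → ℝ) :
    z ⬝ᵥ (blockDiagonal M ⊗ₖ N) *ᵥ z = ∑ b, ∑ r, ∑ s,
      M b r s * ((fun i => z ((r, b), i)) ⬝ᵥ N *ᵥ fun i => z ((s, b), i)) := by
  simp only [dotProduct, mulVec, Fintype.sum_prod_type, kronecker_apply, blockDiagonal_apply]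
  rw [Finset.sum_comm]
  refine Finset.sum_congr rfl fun b _ => Finset.sum_congr rfl fun r _ => ?_
  simp only [ite_mul, zero_mul, Finset.mul_sum]
  rw [Finset.sum_comm]
  refine Finset.sum_congr rfl fun s _ => ?_
  rw [Finset.sum_comm]
  rw [Finset.sum_eq_single b (by simp +contextual [eq_comm]) (by simp)]
  simp only [if_true]
  exact Finset.sum_congr rfl fun i _ => Finset.sum_congr rfl fun j _ => by ring

open Kronecker in
/-- A linear pencil with block diagonal coefficients is positive semidefinite iff each of its
blocks has a nonnegative quadratic form. -/
lemma posSemidef_blockDiagonal_pencil_iff {β κ ι γ : Type*} [Fintype β] [DecidableEq β]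
    [Fintype κ] [Fintype ι] [Fintype γ]
    {A : γ → β → Matrix κ κ ℝ} (hA : ∀ t b, (A t b).IsHermitian)
    {N : γ → Matrix ι ι ℝ} (hN : ∀ t, (N t).IsHermitian) :
    (∑ t, blockDiagonal (A t) ⊗ₖ N t).PosSemidef ↔
      ∀ (b : β) (v : κ → ι → ℝ), 0 ≤ ∑ r, ∑ s, ∑ t, A t b r s * (v r ⬝ᵥ N t *ᵥ v s) := by
  have hq : ∀ z : (κ × β) × ι → ℝ, z ⬝ᵥ (∑ t, blockDiagonal (A t) ⊗ₖ N t) *ᵥ z =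
      ∑ b, ∑ r, ∑ s, ∑ t,
        A t b r s * ((fun i => z ((r, b), i)) ⬝ᵥ N t *ᵥ fun i => z ((s, b), i)) := by
    intro z
    rw [sum_mulVec, dotProduct_sum]
    simp only [dotProduct_blockDiagonal_kronecker_mulVec]
    rw [Finset.sum_comm]
    refine Finset.sum_congr rfl fun b _ => ?_
    rw [Finset.sum_comm]
    refine Finset.sum_congr rfl fun r _ => ?_
    rw [Finset.sum_comm]
  constructor
  · intro h b v
    have h1 := h.dotProduct_mulVec_nonneg fun q => if q.1.2 = b then v q.1.1 q.2 else 0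
    rw [star_trivial, hq, Finset.sum_eq_single b] at h1
    · simpa using h1
    · intro b' _ hb'
      simp [hb', dotProduct]
    · simp
  · intro h
    refine PosSemidef.of_dotProduct_mulVec_nonneg ?_ fun z => ?_
    · refine isSelfAdjoint_sum _ fun t _ => ?_
      have h1 : (blockDiagonal (A t)).IsHermitian := isHermitian_blockDiagonal_iff.2 (hA t)
      rw [isSelfAdjoint_iff, star_eq_conjTranspose, conjTranspose_kronecker, h1.eq, (hN t).eq]
    · rw [star_trivial, hq]
      exact Finset.sum_nonneg fun b _ => h b fun r i => z ((r, b), i)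

open Kronecker in
/-- Finitely many quadratic-form conditions, with fixed symmetric coefficient matrices, on the
matrices `1, X, Y, W₁, …, W_g` are the positivity of a single linear pencil. -/
lemma exists_pencil_iff_forall_block {β κ : Type*} [Fintype β] [DecidableEq β] [Nonempty β]
    [Fintype κ] [Nonempty κ] {g : ℕ} (a : Fin 3 → β → Matrix κ κ ℝ)
    (c : Fin g → β → Matrix κ κ ℝ)
    (ha : ∀ t b, (a t b).IsHermitian) (hc : ∀ j b, (c j b).IsHermitian) :
    ∃ l : ℕ, 1 ≤ l ∧
    ∃ (A₀ A₁ A₂ : Matrix (Fin l) (Fin l) ℝ) (B : Fin g → Matrix (Fin l) (Fin l) ℝ),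
      A₀.IsHermitian ∧ A₁.IsHermitian ∧ A₂.IsHermitian ∧ (∀ j, (B j).IsHermitian) ∧
      ∀ (n : ℕ) (X Y : Matrix (Fin n) (Fin n) ℝ) (W : Fin g → Matrix (Fin n) (Fin n) ℝ),
        X.IsHermitian → Y.IsHermitian → (∀ j, (W j).IsHermitian) →
        ((A₀ ⊗ₖ (1 : Matrix (Fin n) (Fin n) ℝ) + A₁ ⊗ₖ X + A₂ ⊗ₖ Y
              + ∑ j, B j ⊗ₖ W j).PosSemidef ↔
          ∀ (b : β) (v : κ → Fin n → ℝ), 0 ≤ ∑ r, ∑ s,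
            (a 0 b r s * (v r ⬝ᵥ v s) + a 1 b r s * (v r ⬝ᵥ X *ᵥ v s)
              + a 2 b r s * (v r ⬝ᵥ Y *ᵥ v s) + ∑ j, c j b r s * (v r ⬝ᵥ W j *ᵥ v s))) := by
  set e := (Fintype.equivFin (κ × β)).symm with he
  have hH : ∀ M : β → Matrix κ κ ℝ, (∀ b, (M b).IsHermitian) →
      ((blockDiagonal M).submatrix e e).IsHermitian := fun M hM =>
    (isHermitian_blockDiagonal_iff.2 hM).submatrix e
  refine ⟨Fintype.card (κ × β), Fintype.card_pos,
    (blockDiagonal (a 0)).submatrix e e, (blockDiagonal (a 1)).submatrix e e,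
    (blockDiagonal (a 2)).submatrix e e, fun j => (blockDiagonal (c j)).submatrix e e,
    hH _ (ha 0), hH _ (ha 1), hH _ (ha 2), fun j => hH _ (hc j),
    fun n X Y W hX hY hW => ?_⟩
  have hA : ∀ (t : Fin 3 ⊕ Fin g) b, (Sum.elim a c t b).IsHermitian := by
    rintro (t | t) b
    · exact ha t b
    · exact hc t b
  have hN : ∀ t : Fin 3 ⊕ Fin g,
      (Sum.elim ![(1 : Matrix (Fin n) (Fin n) ℝ), X, Y] W t).IsHermitian := by
    rintro (t | t)
    · fin_cases t
      · exact isHermitian_one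
      · exact hX
      · exact hY
    · exact hW t
  have key := posSemidef_blockDiagonal_pencil_iff hA hN
  rw [← posSemidef_submatrix_equiv (e.prodCongr (Equiv.refl (Fin n)))] at key
  simp only [Fintype.sum_sum_type, Fin.sum_univ_three, Sum.elim_inl, Sum.elim_inr] at key
  convert key using 2
  · ext ⟨i, i'⟩ ⟨j, j'⟩
    simp [Matrix.sum_apply]
  · simp

/-- The power `X ^ (2 - k / m)` in terms of `m`-th roots of the eigenvalues. -/
lemma exists_root_spectral {n : ℕ} {X : Matrix (Fin n) (Fin n) ℝ} (hX : X.PosSemidef)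
    {k m : ℕ} (hm : m ≠ 0) (hk : k ≤ m) :
    ∃ (U : Matrix (Fin n) (Fin n) ℝ) (s : Fin n → ℝ), star U * U = 1 ∧ (∀ i, 0 ≤ s i) ∧
      X = U * diagonal (fun i => s i ^ m) * star U ∧
      symPow X (2 - k / m) = U * diagonal (fun i => s i ^ (2 * m - k)) * star U := by
  have hH := hX.isHermitian
  have hnn : ∀ i, 0 ≤ hH.eigenvalues i := hX.eigenvalues_nonneg
  have hm' : (m : ℝ) ≠ 0 := Nat.cast_ne_zero.2 hm
  refine ⟨hH.eigenvectorUnitary, fun i => hH.eigenvalues i ^ (m : ℝ)⁻¹,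
    Unitary.coe_star_mul_self _, fun i => Real.rpow_nonneg (hnn i) _, ?_, ?_⟩
  · have h1 : (fun i => (hH.eigenvalues i ^ (m : ℝ)⁻¹) ^ m) = hH.eigenvalues := by
      ext i
      exact Real.rpow_inv_natCast_pow (hnn i) hm
    rw [h1]
    exact hH.spectral_theorem
  · rw [symPow, dif_pos hH]
    congr 3
    ext i
    rw [← Real.rpow_mul_natCast (hnn i), Nat.cast_sub (by omega)]
    congr 1
    push_cast
    field_simp

lemma exists_eq_two_sub_div {p : ℚ} (hp0 : 1 ≤ p) (hp1 : p ≤ 2) :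
    ∃ k m : ℕ, m ≠ 0 ∧ k ≤ m ∧ (p : ℝ) = 2 - k / m := by
  have hq0 : 0 ≤ 2 - p := by linarith
  have hnum : (((2 - p).num.toNat : ℕ) : ℚ) = (2 - p).num := by
    exact_mod_cast Int.toNat_of_nonneg (Rat.num_nonneg.2 hq0)
  have hdiv : (((2 - p).num.toNat : ℕ) : ℚ) / (2 - p).den = 2 - p := by
    rw [hnum, Rat.num_div_den]
  refine ⟨(2 - p).num.toNat, (2 - p).den, (2 - p).den_nz, ?_, ?_⟩
  · have hden : (0 : ℚ) < (2 - p).den := by exact_mod_cast (2 - p).den_pos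
    have h1 : (((2 - p).num.toNat : ℕ) : ℚ) / (2 - p).den ≤ 1 := by rw [hdiv]; linarith
    rw [div_le_one hden] at h1
    exact_mod_cast h1
  · have h1 : (p : ℚ) = 2 - (((2 - p).num.toNat : ℕ) : ℚ) / (2 - p).den := by
      rw [hdiv]; ring
    have h2 := congrArg (Rat.cast : ℚ → ℝ) h1
    rw [Rat.cast_sub, Rat.cast_div, Rat.cast_natCast, Rat.cast_natCast, Rat.cast_ofNat] at h2
    exact h2

/-- Coefficients of `1`, `X`, `Y` in the blocks `diag(1 - W₀, X - W_m)`, `[Y, X; X, W_k]` and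
`[W_i, W_{i+1}; W_{i+1}, W_{i+2}]`, in this order. -/
def dataCoeff (m : ℕ) : Fin 3 → Option (Option (Fin (m - 1))) → Matrix (Fin 2) (Fin 2) ℝ
  | 0, none => !![1, 0; 0, 0]
  | 1, none => !![0, 0; 0, 1]
  | 1, some none => !![0, 1; 1, 0]
  | 2, some none => !![1, 0; 0, 0]
  | _, _ => 0

/-- Coefficient of `W_j` in the blocks described at `dataCoeff`. -/
def chainCoeff (k m : ℕ) (j : Fin (m + 1)) :
    Option (Option (Fin (m - 1))) → Matrix (Fin 2) (Fin 2) ℝ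
  | none => !![if j = Fin.ofNat (m + 1) 0 then -1 else 0, 0;
      0, if j = Fin.ofNat (m + 1) m then -1 else 0]
  | some none => !![0, 0; 0, if j = Fin.ofNat (m + 1) k then 1 else 0]
  | some (some i) =>
    !![if j = Fin.ofNat (m + 1) i then 1 else 0, if j = Fin.ofNat (m + 1) (i + 1) then 1 else 0;
      if j = Fin.ofNat (m + 1) (i + 1) then 1 else 0,
        if j = Fin.ofNat (m + 1) (i + 2) then 1 else 0]

lemma isHermitian_dataCoeff (m : ℕ) (t : Fin 3) (b : Option (Option (Fin (m - 1)))) :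
    (dataCoeff m t b).IsHermitian := by
  refine IsHermitian.ext fun r s => ?_
  rcases b with _ | _ | b <;> fin_cases t <;> fin_cases r <;> fin_cases s <;> rfl

lemma isHermitian_chainCoeff (k m : ℕ) (j : Fin (m + 1)) (b : Option (Option (Fin (m - 1)))) :
    (chainCoeff k m j b).IsHermitian := by
  refine IsHermitian.ext fun r s => ?_
  rcases b with _ | _ | b <;> fin_cases r <;> fin_cases s <;> rfl

open Kronecker in
/-- For every rational `p ∈ [1,2]`, the epigraph of `X^p` has a free
semidefinite representation: there are fixed real symmetric `ℓ × ℓ` matrices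
`A₀, A₁, A₂, B₁, …, B_{g'}` (independent of `n`) such that for all `n ≥ 1`
and real symmetric `X ⪰ 0`, `Y`:  `X^p ⪯ Y` iff there are real symmetric
`n × n` matrices `W₁, …, W_{g'}` making the linear pencil
`A₀ ⊗ I + A₁ ⊗ X + A₂ ⊗ Y + ∑ⱼ Bⱼ ⊗ Wⱼ` positive semidefinite. -/
theorem power_epigraph_free_sdr (p : ℚ) (hp0 : 1 ≤ p) (hp1 : p ≤ 2) :
    ∃ (l g' : ℕ), 1 ≤ l ∧ 1 ≤ g' ∧
    ∃ (A₀ A₁ A₂ : Matrix (Fin l) (Fin l) ℝ) (B : Fin g' → Matrix (Fin l) (Fin l) ℝ),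
      A₀.IsHermitian ∧ A₁.IsHermitian ∧ A₂.IsHermitian ∧
      (∀ j, (B j).IsHermitian) ∧
      ∀ (n : ℕ), 1 ≤ n →
        ∀ (X Y : Matrix (Fin n) (Fin n) ℝ), X.PosSemidef → Y.IsHermitian →
          ((Y - symPow X (p : ℝ)).PosSemidef
            ↔
          (∃ W : Fin g' → Matrix (Fin n) (Fin n) ℝ,
            (∀ j, (W j).IsHermitian) ∧
            (A₀ ⊗ₖ (1 : Matrix (Fin n) (Fin n) ℝ) + A₁ ⊗ₖ X + A₂ ⊗ₖ Y
              + ∑ j, B j ⊗ₖ W j).PosSemidef)) := by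
  obtain ⟨k, m, hm, hk, hp⟩ := exists_eq_two_sub_div hp0 hp1
  obtain ⟨l, hl, A₀, A₁, A₂, B, hA₀, hA₁, hA₂, hB, hpencil⟩ :=
    exists_pencil_iff_forall_block (dataCoeff m) (chainCoeff k m)
      (isHermitian_dataCoeff m) (isHermitian_chainCoeff k m)
  refine ⟨l, m + 1, hl, by omega, A₀, A₁, A₂, B, hA₀, hA₁, hA₂, hB, fun n _ X Y hX hY => ?_⟩
  obtain ⟨U, s, hU, hs, hXU, hpow⟩ := exists_root_spectral hX hm hk
  have hsymm : ∀ {M : Matrix (Fin n) (Fin n) ℝ}, M.IsHermitian → ∀ x y : Fin n → ℝ,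
      y ⬝ᵥ M *ᵥ x = x ⬝ᵥ M *ᵥ y := by
    intro M hM x y
    rw [dotProduct_mulVec, dotProduct_comm, ← mulVec_transpose,
      ← conjTranspose_eq_transpose_of_trivial, hM.eq]
  rw [hp, hpow, epigraph_iff_exists_chain hU hs hk hY, ← hXU]
  constructor
  · rintro ⟨T, hT, h0, hTm, hchain, hepi⟩
    refine ⟨fun j => T j, fun j => hT j, (hpencil n X Y _ hX.1 hY fun j => hT j).2 ?_⟩
    rintro (_ | _ | i) v
    · have h1 := h0 (v 0)
      have h2 := hTm (v 1)
      simp [Fin.sum_univ_two, dataCoeff, chainCoeff]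
      linarith
    · have h1 := hepi (v 0) (v 1)
      have h2 := hsymm hX.1 (v 0) (v 1)
      have hk' : k % (m + 1) = k := Nat.mod_eq_of_lt (by omega)
      simp [Fin.sum_univ_two, dataCoeff, chainCoeff, hk']
      linarith
    · have hi := i.2
      have h1 := hchain i (by omega) (v 0) (v 1)
      have h2 := hsymm (hT (i + 1)) (v 0) (v 1)
      have hi0 : (i : ℕ) % (m + 1) = i := Nat.mod_eq_of_lt (by omega)
      have hi1 : ((i : ℕ) + 1) % (m + 1) = i + 1 := Nat.mod_eq_of_lt (by omega)
      have hi2 : ((i : ℕ) + 2) % (m + 1) = i + 2 := Nat.mod_eq_of_lt (by omega)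
      simp [Fin.sum_univ_two, dataCoeff, chainCoeff, hi0, hi1, hi2]
      linarith
  · rintro ⟨W, hW, hpsd⟩
    have h := (hpencil n X Y W hX.1 hY hW).1 hpsd
    refine ⟨fun j => W (Fin.ofNat (m + 1) j), fun j => hW _, fun x => ?_, fun x => ?_,
      fun j hj x y => ?_, fun x y => ?_⟩
    · have h1 := h none ![x, 0]
      simp [Fin.sum_univ_two, dataCoeff, chainCoeff] at h1
      simpa using h1
    · have h1 := h none ![0, x]
      simp [Fin.sum_univ_two, dataCoeff, chainCoeff] at h1
      simpa using h1
    · have h1 := h (some (some ⟨j, by omega⟩)) ![x, y]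
      have h2 := hsymm (hW (Fin.ofNat (m + 1) (j + 1))) x y
      simp [Fin.sum_univ_two, dataCoeff, chainCoeff] at h1 h2 ⊢
      linarith
    · have h1 := h (some none) ![x, y]
      have h2 := hsymm hX.1 x y
      simp [Fin.sum_univ_two, dataCoeff, chainCoeff] at h1 h2 ⊢
      linarith
end

section
/- For every rational number p ∈ [−1,0], the epigraph of the matrix power function X^p over positive definite matrices admits a free semidefinite representation: there exist positive integers ℓ and g′ and real symmetric ℓ×ℓ matrices A₀, A₁, A₂, B₁, …, B_{g′} (independent of n) such that for every n ≥ 1, every real symmetric positive definite n×n matrix X, and every real symmetric n×n matrix Y, one has X^p ⪯ Y if and only if there exist real symmetric n×n matrices W₁, …, W_{g′} with A₀ ⊗ I_n + A₁ ⊗ X + A₂ ⊗ Y + Σ_{j=1}^{g′} B_j ⊗ W_j positive semidefinite. -/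
open Matrix

namespace FreePowerRepresentation

open scoped MatrixOrder Matrix.Norms.L2Operator ComplexOrder Kronecker

section Pencil

variable {K σ ι : Type*} [DecidableEq K] [DecidableEq σ]

/-- The variable occupying a position of the symmetric `2 × 2` array `[[u, v], [v, w]]`. -/
def corner (u v w : σ) (r c : Bool) : σ :=
  if r = c then (if r then w else u) else v

/-- The coefficient of the variable `s` in the block diagonal pencil whose `k`-th block is the
array `[[u k, v k], [v k, w k]]` of variables. -/
def coeff (f : ι ≃ K × Bool) (u v w : K → σ) (s : σ) : Matrix ι ι ℝ :=
  Matrix.of fun x y =>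
    if (f x).1 = (f y).1 ∧
      corner (u (f x).1) (v (f x).1) (w (f x).1) (f x).2 (f y).2 = s then 1 else 0

lemma coeff_isHermitian (f : ι ≃ K × Bool) (u v w : K → σ) (s : σ) :
    (coeff f u v w s).IsHermitian := by
  ext x y
  simp only [coeff, Matrix.conjTranspose_apply, Matrix.of_apply, star_trivial, corner]
  refine if_congr ?_ rfl rfl
  grind

lemma posSemidef_blockDiagonal {m : Type*} [Fintype m] [Fintype K]
    {D : K → Matrix m m ℝ} (hD : ∀ k, (D k).PosSemidef) : (Matrix.blockDiagonal D).PosSemidef := by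
  classical
  choose C hC using fun k => CStarAlgebra.nonneg_iff_eq_star_mul_self.mp (hD k).nonneg
  have : Matrix.blockDiagonal D = (Matrix.blockDiagonal C)ᴴ * Matrix.blockDiagonal C := by
    rw [Matrix.blockDiagonal_conjTranspose, ← Matrix.blockDiagonal_mul]
    exact congrArg _ (funext hC)
  rw [this]
  exact Matrix.posSemidef_conjTranspose_mul_self _

lemma pencil_apply [Fintype σ] {n : Type*} (f : ι ≃ K × Bool) (u v w : K → σ)
    (V : σ → Matrix n n ℝ) (x y : ι) (i j : n) :
    (∑ s, coeff f u v w s ⊗ₖ V s) (x, i) (y, j) =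
      if (f x).1 = (f y).1 then
        V (corner (u (f x).1) (v (f x).1) (w (f x).1) (f x).2 (f y).2) i j else 0 := by
  simp only [Matrix.sum_apply, Matrix.kroneckerMap_apply, coeff, Matrix.of_apply, ite_mul,
    one_mul, zero_mul]
  split_ifs with h <;> simp [h]

lemma pencil_posSemidef_iff [Fintype K] [Fintype σ] {n : Type*} [Fintype n]
    (f : ι ≃ K × Bool) (u v w : K → σ) (V : σ → Matrix n n ℝ) :
    (∑ s, coeff f u v w s ⊗ₖ V s).PosSemidef ↔
      ∀ k, (Matrix.fromBlocks (V (u k)) (V (v k)) (V (v k)) (V (w k))).PosSemidef := by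
  constructor
  · intro h k
    convert h.submatrix
      (Sum.elim (fun i => (f.symm (k, false), i)) (fun i => (f.symm (k, true), i))) using 1
    ext (i | i) (j | j) <;> simp only [Matrix.submatrix_apply, Sum.elim_inl, Sum.elim_inr,
      pencil_apply] <;> simp [corner]
  · intro h
    convert (posSemidef_blockDiagonal h).submatrix (fun x : ι × n =>
      ((if (f x.1).2 then Sum.inr x.2 else Sum.inl x.2 : n ⊕ n), (f x.1).1)) using 1
    ext ⟨x, i⟩ ⟨y, j⟩
    rw [pencil_apply, Matrix.submatrix_apply, Matrix.blockDiagonal_apply]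
    refine if_congr Iff.rfl ?_ rfl
    cases (f x).2 <;> cases (f y).2 <;> simp [corner]

end Pencil

section Power

lemma nonneg_of_fromBlocks {n : Type*} {A B C : Matrix n n ℝ}
    (h : (Matrix.fromBlocks A B B C).PosSemidef) : 0 ≤ A ∧ 0 ≤ C :=
  ⟨(h.submatrix Sum.inl).nonneg, (h.submatrix Sum.inr).nonneg⟩

variable {n : Type*} [Fintype n] [DecidableEq n]

/-- The inclusion of real matrices into complex matrices. -/
noncomputable def complexify : Matrix n n ℝ →⋆ₐ[ℝ] Matrix n n ℂ :=
  { Complex.ofRealAm.mapMatrix with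
    map_star' := fun A => by
      ext i j
      simp [Matrix.star_apply] }

lemma complexify_apply (A : Matrix n n ℝ) (i j : n) : complexify A i j = (A i j : ℂ) := rfl

lemma complexify_nonneg_iff {A : Matrix n n ℝ} : 0 ≤ complexify A ↔ 0 ≤ A := by
  constructor
  · intro h
    rw [Matrix.nonneg_iff_posSemidef] at h ⊢
    refine Matrix.PosSemidef.of_dotProduct_mulVec_nonneg ?_ fun x => ?_
    · ext i j
      have := congrFun (congrFun h.isHermitian i) j
      simpa [complexify_apply] using this
    · have := h.dotProduct_mulVec_nonneg (fun i => (x i : ℂ))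
      rw [← Complex.zero_le_real]
      convert this using 1
      simp [dotProduct, Matrix.mulVec, complexify_apply]
  · intro h
    obtain ⟨B, rfl⟩ := CStarAlgebra.nonneg_iff_eq_star_mul_self.mp h
    rw [map_mul, map_star]
    exact star_mul_self_nonneg _

lemma complexify_le_iff {A B : Matrix n n ℝ} : complexify A ≤ complexify B ↔ A ≤ B := by
  rw [← sub_nonneg, ← map_sub, complexify_nonneg_iff, sub_nonneg]

lemma complexify_rpow {A : Matrix n n ℝ} (hA : 0 ≤ A) (p : ℝ) :
    complexify (A ^ p) = complexify A ^ p := by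
  have hA' : 0 ≤ complexify A := complexify_nonneg_iff.mpr hA
  have hcont : Continuous (complexify : Matrix n n ℝ → Matrix n n ℂ) :=
    (complexify (n := n)).toAlgHom.toLinearMap.continuous_of_finiteDimensional
  rw [CFC.rpow_eq_cfc_real hA, CFC.rpow_eq_cfc_real hA']
  exact StarAlgHom.map_cfc complexify (fun x : ℝ => x ^ p) A
    (Matrix.finite_real_spectrum.continuousOn _) hcont hA.isSelfAdjoint hA'.isSelfAdjoint

/-- The Löwner–Heinz inequality for real matrices. -/
lemma rpow_le_rpow {A B : Matrix n n ℝ} (hA : 0 ≤ A) (hAB : A ≤ B) {p : ℝ}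
    (hp : p ∈ Set.Icc (0 : ℝ) 1) : A ^ p ≤ B ^ p := by
  rw [← complexify_le_iff, complexify_rpow hA, complexify_rpow (hA.trans hAB)]
  exact CFC.rpow_le_rpow hp (complexify_le_iff.mpr hAB)

lemma rpow_add_of_nonneg {A : Matrix n n ℝ} {x y : ℝ} (hx : 0 ≤ x) (hy : 0 ≤ y) :
    A ^ (x + y) = A ^ x * A ^ y := by
  simp only [CFC.rpow_def]
  rw [← cfc_mul _ _ A]
  exact cfc_congr fun z _ => NNReal.rpow_add_of_nonneg z hx hy

lemma symPow_eq_rpow {n : ℕ} {X : Matrix (Fin n) (Fin n) ℝ} (hX : 0 ≤ X) (p : ℝ) :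
    symPow X p = X ^ p := by
  have hH : X.IsHermitian := hX.posSemidef.isHermitian
  rw [CFC.rpow_eq_cfc_real hX, hH.cfc_eq, symPow, dif_pos hH, Matrix.IsHermitian.cfc,
    Unitary.conjStarAlgAut_apply]
  rfl

lemma conj_nonneg_of_fromBlocks {A B C S : Matrix n n ℝ} (hS : IsSelfAdjoint S)
    (h : (Matrix.fromBlocks A B B C).PosSemidef) :
    S * B + B * S ≤ S * A * S + C := by
  have hS' : Sᴴ = S := hS
  have := h.conjTranspose_mul_mul_same (Matrix.fromRows (-S) (1 : Matrix n n ℝ))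
  rw [Matrix.conjTranspose_fromRows_eq_fromCols_conjTranspose, Matrix.fromCols_mul_fromBlocks,
    Matrix.fromCols_mul_fromRows, Matrix.conjTranspose_neg, Matrix.conjTranspose_one, hS'] at this
  have heq : (-S * A + 1 * B) * -S + (-S * B + 1 * C) * 1 =
      S * A * S + C - (S * B + B * S) := by noncomm_ring
  rw [heq] at this
  exact this

lemma fromBlocks_rpow_posSemidef {X : Matrix n n ℝ} (hX : X.PosDef) {a b c : ℝ}
    (h : a + c = 2 * b) :
    (Matrix.fromBlocks (X ^ a) (X ^ b) (X ^ b) (X ^ c)).PosSemidef := by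
  have key : ∀ x y z : ℝ, x / 2 + y / 2 = z → (X ^ (x / 2)) * (X ^ (y / 2))ᴴ = X ^ z := by
    intro x y z hz
    have hs : (X ^ (y / 2))ᴴ = X ^ (y / 2) := (CFC.rpow_nonneg).isSelfAdjoint
    rw [hs, ← CFC.rpow_add hX.isUnit, hz]
  convert Matrix.posSemidef_self_mul_conjTranspose
    (Matrix.fromRows (X ^ (a / 2)) (X ^ (c / 2))) using 1
  rw [Matrix.conjTranspose_fromRows_eq_fromCols_conjTranspose, Matrix.fromRows_mul_fromCols,
    key a a a (by ring), key a c b (by linarith), key c a b (by linarith), key c c c (by ring)]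

/-- Along a sequence of matrices with `Z 0 = 1` each of whose terms is dominated by the geometric
mean of its neighbours, `Z i ≤ Z (i + 1) ^ (i / (i + 1))`. -/
lemma le_rpow_succ {N : ℕ} {Z : ℕ → Matrix n n ℝ} (hZ0 : Z 0 = 1)
    (hZ : ∀ i ≤ N, 0 ≤ Z i)
    (hblock : ∀ i, i + 2 ≤ N →
      (Matrix.fromBlocks (Z i) (Z (i + 1)) (Z (i + 1)) (Z (i + 2))).PosSemidef)
    (i : ℕ) (hi : i + 1 ≤ N) : Z i ≤ Z (i + 1) ^ ((i : ℝ) / (i + 1)) := by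
  induction i with
  | zero => simp [hZ0, CFC.rpow_zero _ (hZ 1 hi)]
  | succ i ih =>
    have hA := hZ (i + 1) (by omega)
    set A := Z (i + 1)
    set S := A ^ ((1 : ℝ) / (i + 1)) with hSdef
    have hS : IsSelfAdjoint S := (CFC.rpow_nonneg).isSelfAdjoint
    have hSA : S * A = A ^ (((i : ℝ) + 2) / (i + 1)) := by
      nth_rewrite 1 [← CFC.rpow_one A hA]
      rw [hSdef, ← rpow_add_of_nonneg (by positivity) zero_le_one]
      congr 1
      field_simp
      ring
    have hAS : A * S = A ^ (((i : ℝ) + 2) / (i + 1)) := by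
      nth_rewrite 1 [← CFC.rpow_one A hA]
      rw [hSdef, ← rpow_add_of_nonneg zero_le_one (by positivity)]
      congr 1
      field_simp
      ring
    have hSAS : S * A ^ ((i : ℝ) / (i + 1)) * S = A ^ (((i : ℝ) + 2) / (i + 1)) := by
      rw [hSdef, ← rpow_add_of_nonneg (by positivity) (by positivity),
        ← rpow_add_of_nonneg (by positivity) (by positivity)]
      congr 1
      field_simp
      ring
    have h1 := conj_nonneg_of_fromBlocks hS (hblock i hi)
    have h2 : S * Z i * S ≤ S * A ^ ((i : ℝ) / (i + 1)) * S :=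
      hS.conjugate_le_conjugate (ih (by omega))
    have h3 : A ^ (((i : ℝ) + 2) / (i + 1)) ≤ Z (i + 2) := by
      rw [hSA, hAS] at h1
      rw [hSAS] at h2
      exact le_of_add_le_add_left (h1.trans (add_le_add_left h2 _))
    have h4 := rpow_le_rpow CFC.rpow_nonneg h3 (p := ((i : ℝ) + 1) / (i + 2))
      ⟨by positivity, by rw [div_le_one (by positivity)]; linarith⟩
    rw [CFC.rpow_rpow_of_exponent_nonneg _ _ _ (by positivity) (by positivity) hA,
      div_mul_div_cancel₀' (by positivity), div_self (by positivity), CFC.rpow_one A hA] at h4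
    convert h4 using 2
    push_cast
    ring

lemma le_rpow_of_chain {N m : ℕ} {Z : ℕ → Matrix n n ℝ} (hZ0 : Z 0 = 1)
    (hZ : ∀ i ≤ N, 0 ≤ Z i)
    (hblock : ∀ i, i + 2 ≤ N →
      (Matrix.fromBlocks (Z i) (Z (i + 1)) (Z (i + 1)) (Z (i + 2))).PosSemidef)
    (hm : m ≤ N) : Z m ≤ Z N ^ ((m : ℝ) / N) := by
  rcases Nat.eq_zero_or_pos m with rfl | hm0
  · simp [hZ0, CFC.rpow_zero _ (hZ N le_rfl)]
  suffices ∀ j, m ≤ j → j ≤ N → Z m ≤ Z j ^ ((m : ℝ) / j) from this N hm le_rfl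
  intro j hmj
  induction j, hmj using Nat.le_induction with
  | base =>
    intro _
    rw [div_self (by positivity), CFC.rpow_one _ (hZ m hm)]
  | succ j hmj ih =>
    intro hj
    have hj0 : (0 : ℝ) < j := by exact_mod_cast hm0.trans_le hmj
    have hmj' : (m : ℝ) ≤ j := by exact_mod_cast hmj
    refine (ih (by omega)).trans ?_
    have h := rpow_le_rpow (hZ j (by omega)) (le_rpow_succ hZ0 hZ hblock j hj)
      (p := (m : ℝ) / j) ⟨by positivity, by rw [div_le_one hj0]; exact hmj'⟩
    rw [CFC.rpow_rpow_of_exponent_nonneg _ _ _ (by positivity) (by positivity) (hZ _ hj)] at h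
    convert h using 2
    push_cast
    field_simp

lemma rpow_neg_le_of_fromBlocks {X Y Z : Matrix n n ℝ} (hX : X.PosDef) {q : ℝ}
    (hZ : Z ≤ X ^ q) (h : (Matrix.fromBlocks Y 1 1 Z).PosSemidef) : X ^ (-q) ≤ Y := by
  have hS : IsSelfAdjoint (X ^ (-q)) := (CFC.rpow_nonneg).isSelfAdjoint
  have h' : (Matrix.fromBlocks Z 1 1 Y).PosSemidef := by
    simpa using h.submatrix (Sum.swap : n ⊕ n → n ⊕ n)
  have h1 := conj_nonneg_of_fromBlocks hS h'
  have h2 := hS.conjugate_le_conjugate hZ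
  have h3 : X ^ (-q) * X ^ q = 1 := CFC.rpow_neg_mul_rpow q hX.isStrictlyPositive
  rw [h3, one_mul] at h2
  rw [mul_one, one_mul] at h1
  exact le_of_add_le_add_left (h1.trans (add_le_add_left h2 _))

end Power

/-- The variable in position `i` of the chain of geometric means from the identity, in position
`0`, to `X`, in position `N`. -/
def chainVar (N i : ℕ) : Fin 3 ⊕ Fin (N + 1) :=
  if i = 0 then Sum.inl 0 else if i = N then Sum.inl 1 else Sum.inr (Fin.ofNat (N + 1) i)

/-- The matrices `1, X, Y, W₀, W₁, …` as a single family of variables. -/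
def pencilVars {g n : ℕ} (X Y : Matrix (Fin n) (Fin n) ℝ) (W : Fin g → Matrix (Fin n) (Fin n) ℝ) :
    Fin 3 ⊕ Fin g → Matrix (Fin n) (Fin n) ℝ :=
  Sum.elim ![1, X, Y] W

lemma pencilVars_chainVar_rpow {n N i : ℕ} {X Y : Matrix (Fin n) (Fin n) ℝ} (hX : 0 ≤ X)
    (hi : i ≤ N) (hN : 0 < N) :
    pencilVars X Y (fun j : Fin (N + 1) => X ^ ((j : ℝ) / N)) (chainVar N i) =
      X ^ ((i : ℝ) / N) := by
  unfold pencilVars chainVar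
  split_ifs with h0 hN'
  · simp [h0, CFC.rpow_zero X hX]
  · have : (N : ℝ) ≠ 0 := by positivity
    simp [hN', div_self this, CFC.rpow_one X hX]
  · simp [Nat.mod_eq_of_lt (Nat.lt_succ_of_le hi)]

/-- `X ^ (-m / N) ≤ Y` is a conjunction of conditions on `2 × 2` blocks with auxiliary variables
standing for the powers `X ^ (i / N)`. -/
lemma rpow_neg_le_iff {N m : ℕ} (hN : 0 < N) (hm : m ≤ N) {n : ℕ}
    {X Y : Matrix (Fin n) (Fin n) ℝ} (hX : X.PosDef) :
    X ^ (-((m : ℝ) / N)) ≤ Y ↔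
      ∃ W : Fin (N + 1) → Matrix (Fin n) (Fin n) ℝ, (∀ j, (W j).IsHermitian) ∧
        (Matrix.fromBlocks Y 1 1 (pencilVars X Y W (chainVar N m))).PosSemidef ∧
        ∀ i ≤ N, ∀ j ≤ N, ∀ k ≤ N, i + k = 2 * j →
          (Matrix.fromBlocks (pencilVars X Y W (chainVar N i))
            (pencilVars X Y W (chainVar N j)) (pencilVars X Y W (chainVar N j))
            (pencilVars X Y W (chainVar N k))).PosSemidef := by
  have hX0 := hX.posSemidef.nonneg
  constructor
  · intro h
    refine ⟨fun j => X ^ ((j : ℝ) / N), fun j => (CFC.rpow_nonneg).isSelfAdjoint, ?_, ?_⟩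
    · rw [pencilVars_chainVar_rpow hX0 hm hN]
      have h1 := fromBlocks_rpow_posSemidef hX
        (show -((m : ℝ) / N) + (m : ℝ) / N = 2 * 0 by ring)
      have h2 : (Matrix.fromBlocks (Y - X ^ (-((m : ℝ) / N))) 0 0
          (0 : Matrix (Fin n) (Fin n) ℝ)).PosSemidef := by
        have := (Matrix.le_iff.mp h).mul_mul_conjTranspose_same
          (Matrix.fromRows (1 : Matrix (Fin n) (Fin n) ℝ) (0 : Matrix (Fin n) (Fin n) ℝ))
        rw [Matrix.conjTranspose_fromRows_eq_fromCols_conjTranspose, Matrix.fromRows_mul,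
          Matrix.fromRows_mul_fromCols] at this
        simpa using this
      convert h1.add h2 using 1
      rw [Matrix.fromBlocks_add]
      simp [CFC.rpow_zero X hX0]
    · intro i hi j hj k hk hijk
      rw [pencilVars_chainVar_rpow hX0 hi hN, pencilVars_chainVar_rpow hX0 hj hN,
        pencilVars_chainVar_rpow hX0 hk hN]
      have hijk' : (i : ℝ) + k = 2 * j := by exact_mod_cast hijk
      exact fromBlocks_rpow_posSemidef hX (by rw [← add_div, hijk', mul_div_assoc])
  · rintro ⟨W, -, hY, hblock⟩
    have hone : pencilVars X Y W (chainVar N 0) = 1 := by simp [pencilVars, chainVar]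
    have hlast : pencilVars X Y W (chainVar N N) = X := by simp [pencilVars, chainVar, hN.ne']
    refine rpow_neg_le_of_fromBlocks hX ?_ hY
    have := le_rpow_of_chain (Z := fun i => pencilVars X Y W (chainVar N i)) hone
      (fun i hi => (nonneg_of_fromBlocks (hblock i hi i hi i hi (by omega))).1)
      (fun i hi => hblock i (by omega) (i + 1) (by omega) (i + 2) hi (by omega)) hm
    simpa only [hlast] using this

end FreePowerRepresentation

open FreePowerRepresentation

open Kronecker in
/-- For every rational `p ∈ [-1,0]`, the epigraph of `X^p` over positive
definite matrices has a free semidefinite representation: there are fixed real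
symmetric `ℓ × ℓ` matrices `A₀, A₁, A₂, B₁, …, B_{g'}` (independent of `n`)
such that for all `n ≥ 1`, real symmetric positive definite `X` and real
symmetric `Y`:  `X^p ⪯ Y` iff there are real symmetric `n × n` matrices
`W₁, …, W_{g'}` making the linear pencil
`A₀ ⊗ I + A₁ ⊗ X + A₂ ⊗ Y + ∑ⱼ Bⱼ ⊗ Wⱼ` positive semidefinite. -/
theorem negative_power_epigraph_free_sdr (p : ℚ) (hp0 : -1 ≤ p) (hp1 : p ≤ 0) :
    ∃ (l g' : ℕ), 1 ≤ l ∧ 1 ≤ g' ∧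
    ∃ (A₀ A₁ A₂ : Matrix (Fin l) (Fin l) ℝ) (B : Fin g' → Matrix (Fin l) (Fin l) ℝ),
      A₀.IsHermitian ∧ A₁.IsHermitian ∧ A₂.IsHermitian ∧
      (∀ j, (B j).IsHermitian) ∧
      ∀ (n : ℕ), 1 ≤ n →
        ∀ (X Y : Matrix (Fin n) (Fin n) ℝ), X.PosDef → Y.IsHermitian →
          ((Y - symPow X (p : ℝ)).PosSemidef
            ↔
          (∃ W : Fin g' → Matrix (Fin n) (Fin n) ℝ,
            (∀ j, (W j).IsHermitian) ∧
            (A₀ ⊗ₖ (1 : Matrix (Fin n) (Fin n) ℝ) + A₁ ⊗ₖ X + A₂ ⊗ₖ Y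
              + ∑ j, B j ⊗ₖ W j).PosSemidef)) := by
  have hN : 0 < p.den := p.den_pos
  obtain ⟨m, hm⟩ : ∃ m : ℕ, p.num = -(m : ℤ) :=
    ⟨p.num.natAbs, by have := Rat.num_nonpos.mpr hp1; omega⟩
  have hpeq : (p : ℝ) = -((m : ℝ) / p.den) := by
    rw [Rat.cast_def, hm]
    push_cast
    ring
  have hmN : m ≤ p.den := by
    have h : (-1 : ℝ) ≤ p := by exact_mod_cast hp0
    rw [hpeq, neg_le_neg_iff, div_le_one (by exact_mod_cast hN)] at h
    exact_mod_cast h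
  let N := p.den
  let K := Option {t : Fin (N + 1) × Fin (N + 1) × Fin (N + 1) //
    (t.1 : ℕ) + t.2.2 = 2 * (t.2.1 : ℕ)}
  let f : Fin (Fintype.card (K × Bool)) ≃ K × Bool := (Fintype.equivFin _).symm
  let u : K → Fin 3 ⊕ Fin (N + 1) := fun k => k.elim (Sum.inl 2) fun t => chainVar N t.1.1
  let v : K → Fin 3 ⊕ Fin (N + 1) := fun k => k.elim (Sum.inl 0) fun t => chainVar N t.1.2.1
  let w : K → Fin 3 ⊕ Fin (N + 1) := fun k => k.elim (chainVar N m) fun t => chainVar N t.1.2.2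
  refine ⟨Fintype.card (K × Bool), N + 1, Fintype.card_pos, by omega,
    coeff f u v w (Sum.inl 0), coeff f u v w (Sum.inl 1), coeff f u v w (Sum.inl 2),
    fun j => coeff f u v w (Sum.inr j), coeff_isHermitian _ _ _ _ _, coeff_isHermitian _ _ _ _ _,
    coeff_isHermitian _ _ _ _ _, fun j => coeff_isHermitian _ _ _ _ _, ?_⟩
  intro n _ X Y hX _
  rw [symPow_eq_rpow hX.posSemidef.nonneg, hpeq, ← Matrix.le_iff, rpow_neg_le_iff hN hmN hX]
  refine exists_congr fun W => and_congr_right fun _ => ?_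
  have hpencil := pencil_posSemidef_iff f u v w (pencilVars X Y W)
  rw [Fintype.sum_sum_type, Fin.sum_univ_three] at hpencil
  refine Iff.trans ?_ hpencil.symm
  constructor
  · rintro ⟨hY, hblock⟩ (_ | ⟨⟨i, j, k⟩, h⟩)
    · exact hY
    · exact hblock i (by omega) j (by omega) k (by omega) h
  · intro h
    refine ⟨h none, fun i hi j hj k hk hijk => ?_⟩
    exact h (some ⟨(⟨i, by omega⟩, ⟨j, by omega⟩, ⟨k, by omega⟩), hijk⟩)
end

section
/- Let A = [[4,0],[0,1]], X₁ = [[2,0],[0,1]], and X₂ = [[3,1],[1,133/64]] be real symmetric 2×2 matrices. Then X₁ ⪰ 0, X₂ ⪰ 0, X₁² ⪰ A, and X₂² ⪰ A, but Z = (X₁ + X₂)/2 satisfies Z ⪰ 0 while Z² ⪰ A fails (indeed det(Z² − A) = −2079/65536 < 0). Consequently the set Q = {X ∈ S² : X² ⪰ A, X ⪰ 0} of real symmetric 2×2 matrices is not convex. -/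
open Matrix

/-- A real symmetric 2×2 matrix with nonnegative principal minors is positive semidefinite. -/
lemma posSemidef_fin_two_of_minors_nonneg {a b c : ℝ} (ha : 0 ≤ a) (hc : 0 ≤ c)
    (hdet : b ^ 2 ≤ a * c) : (!![a, b; b, c]).PosSemidef := by
  refine PosSemidef.of_dotProduct_mulVec_nonneg ?_ fun x => ?_
  · ext i j
    fin_cases i <;> fin_cases j <;> simp
  · have hform : star x ⬝ᵥ (!![a, b; b, c] *ᵥ x)
        = a * x 0 ^ 2 + 2 * b * (x 0 * x 1) + c * x 1 ^ 2 := by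
      simp [dotProduct, mulVec, Fin.sum_univ_two]
      ring
    rw [hform]
    rcases ha.eq_or_lt with rfl | ha
    · have hb : b = 0 := by nlinarith
      subst hb
      nlinarith [mul_nonneg hc (sq_nonneg (x 1))]
    · refine nonneg_of_mul_nonneg_right (a := a) ?_ ha
      nlinarith [sq_nonneg (a * x 0 + b * x 1),
        mul_nonneg (sub_nonneg.2 hdet) (sq_nonneg (x 1))]

/-- With `A = [[4,0],[0,1]]`, `X₁ = [[2,0],[0,1]]`, `X₂ = [[3,1],[1,133/64]]`
one has `X₁ ⪰ 0`, `X₂ ⪰ 0`, `X₁² ⪰ A`, `X₂² ⪰ A`, while `Z = (X₁ + X₂)/2`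
satisfies `Z ⪰ 0` but not `Z² ⪰ A` (indeed `det(Z² − A) = −2079/65536 < 0`).
Hence `Q = {X ∈ S² : X² ⪰ A, X ⪰ 0}` is not convex. -/
theorem square_superlevel_not_convex :
    (!![(2 : ℝ), 0; 0, 1]).PosSemidef ∧
    (!![(3 : ℝ), 1; 1, 133/64]).PosSemidef ∧
    (!![(2 : ℝ), 0; 0, 1] ^ 2 - !![(4 : ℝ), 0; 0, 1]).PosSemidef ∧
    (!![(3 : ℝ), 1; 1, 133/64] ^ 2 - !![(4 : ℝ), 0; 0, 1]).PosSemidef ∧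
    ((1 / 2 : ℝ) • (!![(2 : ℝ), 0; 0, 1] + !![(3 : ℝ), 1; 1, 133/64])).PosSemidef ∧
    ¬ (((1 / 2 : ℝ) • (!![(2 : ℝ), 0; 0, 1] + !![(3 : ℝ), 1; 1, 133/64])) ^ 2
        - !![(4 : ℝ), 0; 0, 1]).PosSemidef ∧
    (((1 / 2 : ℝ) • (!![(2 : ℝ), 0; 0, 1] + !![(3 : ℝ), 1; 1, 133/64])) ^ 2
        - !![(4 : ℝ), 0; 0, 1]).det = -2079/65536 ∧
    ¬ Convex ℝ {X : Matrix (Fin 2) (Fin 2) ℝ |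
        X.IsHermitian ∧ (X ^ 2 - !![(4 : ℝ), 0; 0, 1]).PosSemidef ∧ X.PosSemidef} := by
  have hX₁ : (!![(2 : ℝ), 0; 0, 1]).PosSemidef :=
    posSemidef_fin_two_of_minors_nonneg (by norm_num) (by norm_num) (by norm_num)
  have hX₂ : (!![(3 : ℝ), 1; 1, 133/64]).PosSemidef :=
    posSemidef_fin_two_of_minors_nonneg (by norm_num) (by norm_num) (by norm_num)
  have hX₁sq : (!![(2 : ℝ), 0; 0, 1] ^ 2 - !![(4 : ℝ), 0; 0, 1]).PosSemidef := by
    have hsq : !![(2 : ℝ), 0; 0, 1] ^ 2 - !![(4 : ℝ), 0; 0, 1] = 0 := by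
      ext i j
      fin_cases i <;> fin_cases j <;> norm_num [pow_two]
    rw [hsq]
    exact .zero
  have hX₂sq : (!![(3 : ℝ), 1; 1, 133/64] ^ 2 - !![(4 : ℝ), 0; 0, 1]).PosSemidef := by
    have hsq : !![(3 : ℝ), 1; 1, 133/64] ^ 2 - !![(4 : ℝ), 0; 0, 1]
        = !![6, 325/64; 325/64, 17689/4096] := by
      ext i j
      fin_cases i <;> fin_cases j <;> norm_num [pow_two]
    rw [hsq]
    exact posSemidef_fin_two_of_minors_nonneg (by norm_num) (by norm_num) (by norm_num)
  have hdet : (((1 / 2 : ℝ) • (!![(2 : ℝ), 0; 0, 1] + !![(3 : ℝ), 1; 1, 133/64])) ^ 2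
      - !![(4 : ℝ), 0; 0, 1]).det = -2079/65536 := by
    norm_num [pow_two, det_fin_two]
  have hZsq : ¬ (((1 / 2 : ℝ) • (!![(2 : ℝ), 0; 0, 1] + !![(3 : ℝ), 1; 1, 133/64])) ^ 2
      - !![(4 : ℝ), 0; 0, 1]).PosSemidef := fun h => by
    have hnonneg := h.det_nonneg
    rw [hdet] at hnonneg
    norm_num at hnonneg
  refine ⟨hX₁, hX₂, hX₁sq, hX₂sq, (hX₁.add hX₂).smul (by norm_num), hZsq, hdet, fun hconv => ?_⟩
  have hmid := hconv ⟨hX₁.isHermitian, hX₁sq, hX₁⟩ ⟨hX₂.isHermitian, hX₂sq, hX₂⟩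
    (by norm_num : (0 : ℝ) ≤ 1 / 2) (by norm_num : (0 : ℝ) ≤ 1 / 2) (by norm_num)
  rw [← smul_add] at hmid
  exact hZsq hmid.2.1
end

section
/- The set {(X₀, X₁) : X₀, X₁ real symmetric positive semidefinite 2×2 matrices with X₁ X₀ X₁ ⪰ I₂} is not a convex subset of pairs of real symmetric 2×2 matrices. -/
open Matrix

/-- A real symmetric `2 × 2` matrix with positive upper left entry and nonnegative determinant is
positive semidefinite. -/
theorem posSemidef_fin_two_of_pos_of_sq_le {a b c : ℝ} (ha : 0 < a) (h : b ^ 2 ≤ a * c) :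
    (!![a, b; b, c] : Matrix (Fin 2) (Fin 2) ℝ).PosSemidef := by
  refine .of_dotProduct_mulVec_nonneg ?_ fun x => ?_
  · ext i j
    fin_cases i <;> fin_cases j <;> simp
  · simp only [dotProduct, mulVec, Fin.sum_univ_two, star_trivial, of_apply, cons_val_zero,
      cons_val_one]
    refine nonneg_of_mul_nonneg_right ?_ ha
    nlinarith [sq_nonneg (a * x 0 + b * x 1), mul_nonneg (sub_nonneg.2 h) (sq_nonneg (x 1))]

/-- The set `{(X₀, X₁) : X₀ ⪰ 0, X₁ ⪰ 0, X₁ X₀ X₁ ⪰ I}` of pairs of real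
symmetric positive semidefinite `2 × 2` matrices is not convex. -/
theorem cubic_root_set_not_convex :
    ¬ Convex ℝ {P : Matrix (Fin 2) (Fin 2) ℝ × Matrix (Fin 2) (Fin 2) ℝ |
        P.1.PosSemidef ∧ P.2.PosSemidef ∧
        (P.2 * P.1 * P.2 - 1).PosSemidef} := by
  intro hconv
  -- Both points have the form `(A⁻², A)`; their midpoint violates the cubic inequality.
  have key := hconv
    (x := (!![1, 0; 0, 1 / 4], !![1, 0; 0, 2]))
    ⟨posSemidef_fin_two_of_pos_of_sq_le (by norm_num) (by norm_num),
      posSemidef_fin_two_of_pos_of_sq_le (by norm_num) (by norm_num), by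
        convert PosSemidef.zero using 1
        ext i j
        fin_cases i <;> fin_cases j <;> norm_num [mul_apply, Fin.sum_univ_two]⟩
    (y := (!![2 / 5, -1 / 5; -1 / 5, 1 / 5], !![2, 1; 1, 3]))
    ⟨posSemidef_fin_two_of_pos_of_sq_le (by norm_num) (by norm_num),
      posSemidef_fin_two_of_pos_of_sq_le (by norm_num) (by norm_num), by
        convert PosSemidef.zero using 1
        ext i j
        fin_cases i <;> fin_cases j <;> norm_num [mul_apply, Fin.sum_univ_two]⟩
    (a := 1 / 2) (b := 1 / 2) (by norm_num) (by norm_num) (by norm_num)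
  have hneg := key.2.2.dotProduct_mulVec_nonneg ![5, -6]
  norm_num [dotProduct, mulVec, mul_apply, Fin.sum_univ_two] at hneg
end
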